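/- arXiv:1311.0522 — 4 statements merged into one kernel-verified Lean document; each statement's English description precedes it below -/
import Mathlib

section
/- Let G be a finite simple cubic graph (not necessarily bridgeless) and H a hexagon graph of G. Then every pair of vertex-disjoint edges of H that does not consist of one blue edge and one white edge is contained in a perfect matching of H. -/
open SimpleGraph

namespace Hex

variable {V : Type}

/-- A graph is cubic (3-regular) if every vertex has exactly 3 neighbors. -/
def IsCubic (G : SimpleGraph V) : Prop := ∀ v : V, (G.neighborSet v).ncard = 3

/-- A graph is bridgeless if none of its edges is a bridge. -/
def Bridgeless (G : SimpleGraph V) : Prop := ∀ e ∈ G.edgeSet, ¬G.IsBridge e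

/-- A valid assignment of the indices `i_{v(u)} ∈ {0,1,2}`: with each neighbor `u` of `v`
an index in `{0,1,2}` is associated, pairwise distinct for distinct neighbors. -/
def GoodIdx (G : SimpleGraph V) (idx : V → V → ZMod 6) : Prop :=
  (∀ v u : V, G.Adj v u → (idx v u).val < 3) ∧
  (∀ v u w : V, G.Adj v u → G.Adj v w → u ≠ w → idx v u ≠ idx v w)

/-- The pair of white edges `(e_{uv}, e'_{uv})` replacing the edge `uv` of `G`.
A vertex `v_i` belongs to the class `X` iff `i` is even, to `Y` iff `i` is odd. -/
def whitePairs (idx : V → V → ZMod 6) (u v : V) :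
    Sym2 (V × ZMod 6) × Sym2 (V × ZMod 6) :=
  if (idx u v).val % 2 = (idx v u).val % 2 then
    (s((u, idx u v), (v, idx v u + 3)), s((u, idx u v + 3), (v, idx v u)))
  else
    (s((u, idx u v), (v, idx v u)), s((u, idx u v + 3), (v, idx v u + 3)))

/-- The white edges of the hexagon graph. -/
def IsWhite (G : SimpleGraph V) (idx : V → V → ZMod 6) (e : Sym2 (V × ZMod 6)) : Prop :=
  ∃ u v : V, G.Adj u v ∧ (e = (whitePairs idx u v).1 ∨ e = (whitePairs idx u v).2)

/-- The red edges of the hexagon graph: the edges `v_i v_{i+3}`. -/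
def IsRed (e : Sym2 (V × ZMod 6)) : Prop :=
  ∃ (v : V) (i : ZMod 6), e = s((v, i), (v, i + 3))

/-- The blue edges of the hexagon graph: the edges `v_i v_{i+1}`. -/
def IsBlue (e : Sym2 (V × ZMod 6)) : Prop :=
  ∃ (v : V) (i : ZMod 6), e = s((v, i), (v, i + 1))

/-- The hexagon graph of `G` with respect to an index assignment `idx`: each vertex `v` of `G`
is replaced by a hexagon (a copy of `K_{3,3}` with vertex set `{v} × ZMod 6`, and edge set
`{v_i v_{i+1}} ∪ {v_i v_{i+3}}`), and each edge `uv` of `G` is replaced by the two white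
edges `e_{uv}`, `e'_{uv}`. -/
def hexagonGraph (G : SimpleGraph V) (idx : V → V → ZMod 6) : SimpleGraph (V × ZMod 6) :=
  SimpleGraph.fromRel fun p q =>
    (p.1 = q.1 ∧ (q.2 = p.2 + 1 ∨ q.2 = p.2 + 3)) ∨ IsWhite G idx s(p, q)

/-- A blue perfect matching of the hexagon graph: a perfect matching all of whose edges
are blue. -/
def IsBluePM (G : SimpleGraph V) (idx : V → V → ZMod 6)
    (M : (hexagonGraph G idx).Subgraph) : Prop :=
  M.IsPerfectMatching ∧ ∀ e ∈ M.edgeSet, IsBlue e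

/-- The graph `M Δ W` on the vertices of the hexagon graph, whose edge set is the symmetric
difference of the edge set of `M` and the set `W` of white edges. Its connected components
are the cycles of `M Δ W`. -/
def sdGraph (G : SimpleGraph V) (idx : V → V → ZMod 6)
    (M : (hexagonGraph G idx).Subgraph) : SimpleGraph (V × ZMod 6) :=
  SimpleGraph.fromEdgeSet (symmDiff M.edgeSet {e | IsWhite G idx e})

/-- The edge set of the subgraph of `G` induced by the cycle (connected component) `c`
of `M Δ W`: the edges `uv` of `G` such that `e_{uv}` or `e'_{uv}` belongs to `c`. -/
def inducedSet (G : SimpleGraph V) (idx : V → V → ZMod 6)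
    (M : (hexagonGraph G idx).Subgraph)
    (c : (sdGraph G idx M).ConnectedComponent) : Set (Sym2 V) :=
  {e | ∃ (u v : V) (i j : ZMod 6), (sdGraph G idx M).Adj (u, i) (v, j) ∧ u ≠ v ∧
    (sdGraph G idx M).connectedComponentMk (u, i) = c ∧ e = s(u, v)}

/-- A rotation system of `G`: for each vertex `v`, a cyclic permutation of the edges
incident with `v` (encoded on darts with tail `v`). -/
structure RotationSystem (G : SimpleGraph V) where
  σ : G.Dart ≃ G.Dart
  tail_eq : ∀ d : G.Dart, (σ d).toProd.1 = d.toProd.1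
  cyclic : ∀ d d' : G.Dart, d.toProd.1 = d'.toProd.1 → ∃ n : ℕ, (⇑σ)^[n] d = d'

/-- The face-traversal map of a rotation system: after traversing the dart `d = (v, w)`,
the next dart is obtained by applying the rotation at `w` to the edge of `d`. -/
def facePerm {G : SimpleGraph V} (ρ : RotationSystem G) : G.Dart → G.Dart :=
  fun d => ρ.σ d.symm

/-- The face boundaries of a rotation system, as edge sets of `G`. -/
def faceSets {G : SimpleGraph V} (ρ : RotationSystem G) : Set (Set (Sym2 V)) :=
  {S | ∃ d : G.Dart, S = {e | ∃ n : ℕ, ((facePerm ρ)^[n] d).edge = e}}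

/-- The cyclic shift `0 ↦ 1 ↦ 2 ↦ 0` on the index set `{0,1,2} ⊂ ZMod 6`. -/
def rot3 (a : ZMod 6) : ZMod 6 := if a = 2 then 0 else a + 1

/-- The cyclic shift `0 ↦ 2 ↦ 1 ↦ 0` on the index set `{0,1,2} ⊂ ZMod 6`. -/
def rot3inv (a : ZMod 6) : ZMod 6 := if a = 0 then 2 else a - 1

/-- An edge `e` belongs to the cycle (connected component) `c` of a graph `K`. -/
def edgeInComp {W : Type} (K : SimpleGraph W) (e : Sym2 W) (c : K.ConnectedComponent) :
    Prop :=
  e ∈ K.edgeSet ∧ ∀ x ∈ e, K.connectedComponentMk x = c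

/-- A blue perfect matching `M` is safe if no cycle of `M Δ W` contains both end vertices
of a red edge, i.e. no component of `M Δ W` contains both `(v, i)` and `(v, i + 3)`. -/
def SafePM (G : SimpleGraph V) (idx : V → V → ZMod 6)
    (M : (hexagonGraph G idx).Subgraph) : Prop :=
  ∀ (v : V) (i : ZMod 6), ¬(sdGraph G idx M).Reachable (v, i) (v, i + 3)

/-- A directed cycle double cover of `G`: a family of directed cycles (cycles traversed
in a chosen direction) such that every dart of `G` is traversed by exactly one member;
equivalently, every edge lies on exactly two members and they induce opposite
orientations on it. -/
def HasDCDC (G : SimpleGraph V) : Prop :=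
  ∃ (ι : Type) (F : ι → Σ v : V, G.Walk v v),
    (∀ i, (F i).2.IsCycle) ∧ ∀ d : G.Dart, ∃! i, d ∈ (F i).2.darts

/-- A brace: a simple connected bipartite graph on at least six vertices that has a
perfect matching and such that every pair of vertex-disjoint edges is contained in a
perfect matching. -/
def IsBrace {W : Type} [Fintype W] (H : SimpleGraph W) : Prop :=
  H.Connected ∧ H.Colorable 2 ∧ 6 ≤ Fintype.card W ∧
  (∃ M : H.Subgraph, M.IsPerfectMatching) ∧
  ∀ e₁ ∈ H.edgeSet, ∀ e₂ ∈ H.edgeSet, (∀ x ∈ e₁, x ∉ e₂) →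
    ∃ M : H.Subgraph, M.IsPerfectMatching ∧ e₁ ∈ M.edgeSet ∧ e₂ ∈ M.edgeSet

/-- The ladder `L_{2n}`: vertices `a_0, …, a_{n-1}, b_0, …, b_{n-1}`, with edges
`a_i a_{i+1}`, `b_i b_{i+1}` (indices mod `n`) and the rungs `a_i b_i`.
In particular `ladder 4` is the ladder `L_8` on 8 vertices. -/
def ladder (n : ℕ) : SimpleGraph (Fin 2 × ZMod n) :=
  SimpleGraph.fromRel fun p q => (p.1 = q.1 ∧ q.2 = p.2 + 1) ∨ (p.1 ≠ q.1 ∧ p.2 = q.2)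

/-- The expansion of a vertex `x` to a path `x¹ v x²`, relative to the part `N1` of a
partition `(N1, N(x) \ N1)` of the neighborhood of `x`: `x` is deleted, the new path
`x¹ v x²` is added (here `v := Sum.inl x`, `x¹ := Sum.inr 0`, `x² := Sum.inr 1`), every
vertex of `N1` is joined to `x¹` and every other neighbor of `x` is joined to `x²`. -/
def expansion {α : Type} (H : SimpleGraph α) (x : α) (N1 : Set α) :
    SimpleGraph (α ⊕ Fin 2) :=
  SimpleGraph.fromRel fun p q =>
    match p, q with
    | Sum.inl a, Sum.inl b => H.Adj a b ∧ a ≠ x ∧ b ≠ x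
    | Sum.inr i, Sum.inl a =>
        (a = x ∧ (i = 0 ∨ i = 1)) ∨ (i = 0 ∧ a ∈ N1 ∧ H.Adj x a) ∨
        (i = 1 ∧ a ∉ N1 ∧ H.Adj x a)
    | _, _ => False

/-- `H'` is obtained from `H` by a type-1 augmentation: one new edge is added so that the
result is bipartite (stated up to isomorphism). -/
def IsType1Aug {α β : Type} (H : SimpleGraph α) (H' : SimpleGraph β) : Prop :=
  ∃ x y : α, x ≠ y ∧ ¬H.Adj x y ∧
    (SimpleGraph.fromEdgeSet (insert s(x, y) H.edgeSet)).Colorable 2 ∧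
    Nonempty (H' ≃g SimpleGraph.fromEdgeSet (insert s(x, y) H.edgeSet))

/-- `H'` is obtained from `H` by a type-2 augmentation: a vertex `x` of degree at least 4
is expanded to `x¹ v x²` (with both parts of the neighborhood partition of size at least 2)
and a new edge `v w` is added, where `w` is a vertex in the same partition class as `x`
(stated up to isomorphism). -/
def IsType2Aug {α β : Type} (H : SimpleGraph α) (H' : SimpleGraph β) : Prop :=
  ∃ (x w : α) (N1 : Set α),
    4 ≤ (H.neighborSet x).ncard ∧ N1 ⊆ H.neighborSet x ∧ 2 ≤ N1.ncard ∧
    2 ≤ (H.neighborSet x \ N1).ncard ∧ w ≠ x ∧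
    (∃ C : H.Coloring (Fin 2), C w = C x) ∧
    Nonempty (H' ≃g SimpleGraph.fromEdgeSet
      (insert s(Sum.inl x, Sum.inl w) (expansion H x N1).edgeSet))

/-- A bundled graph (a graph together with its vertex type). -/
structure BundledGraph : Type 1 where
  carrier : Type
  graph : SimpleGraph carrier

/-- A simple augmentation: a type-1 or a type-2 augmentation. -/
def IsSimpleAug (A B : BundledGraph) : Prop :=
  IsType1Aug A.graph B.graph ∨ IsType2Aug A.graph B.graph

/-- The set of vertices of the square `s_v` that are covered by an edge of `S`
(for `S` the projection of an edge or path, these are the vertices of its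
supporting edge in `s_v`). -/
def sqSupp (v : V) (S : Set (Sym2 (V × ZMod 4))) : Set (V × ZMod 4) :=
  {p | p.1 = v ∧ ∃ e ∈ S, p ∈ e}

/-- An `M`-square graph of `G`: each vertex `v` of `G` is replaced by a square `s_v`
(a copy of `K_{2,2}` on `{v} × ZMod 4`, with edge set `{v_j v_{j+1}}`), and each edge `uv`
of `G` is replaced by its projection `pr u v`, a set of two edges forming, together with a
supporting edge in each of `s_u`, `s_v`, a copy of `K_{2,2}`; whenever `uv ∈ M` and `w, z`
are the other two neighbors of `v`, the supporting edges of `pr w v` and `pr z v` in `s_v`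
are vertex-disjoint. -/
structure SquareGraph (G : SimpleGraph V) (M : Set (Sym2 V)) where
  Q : SimpleGraph (V × ZMod 4)
  pr : V → V → Set (Sym2 (V × ZMod 4))
  bip : Q.Colorable 2
  intra : ∀ (v : V) (j k : ZMod 4), Q.Adj (v, j) (v, k) ↔ (k = j + 1 ∨ j = k + 1)
  pr_symm : ∀ u v : V, pr u v = pr v u
  pr_shape : ∀ u v : V, G.Adj u v → ∃ j k : ZMod 4,
    pr u v = {s((u, j), (v, k)), s((u, j + 1), (v, k + 1))} ∨
    pr u v = {s((u, j), (v, k)), s((u, j + 1), (v, k + 3))}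
  inter : ∀ (u v : V) (j k : ZMod 4), u ≠ v →
    (Q.Adj (u, j) (v, k) ↔ G.Adj u v ∧ s((u, j), (v, k)) ∈ pr u v)
  matched : ∀ v u w z : V, G.Adj v u → G.Adj v w → G.Adj v z → u ≠ w → u ≠ z → w ≠ z →
    s(u, v) ∈ M → Disjoint (sqSupp v (pr w v)) (sqSupp v (pr z v))

/-- An odd ear decomposition of `G`: a sequence of subgraphs `G_0, …, G_l` where `G_0` is
an even cycle, `G_l = G`, and each `G_i` is obtained from `G_{i-1}` by attaching an odd
path (ear) whose ends lie in `G_{i-1}` and which is otherwise disjoint from `G_{i-1}`. -/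
structure OddEarDecomp (G : SimpleGraph V) where
  l : ℕ
  Gs : Fin (l + 1) → G.Subgraph
  base : ∃ (v : V) (c : G.Walk v v), c.IsCycle ∧ Even c.length ∧ Gs 0 = c.toSubgraph
  top : Gs (Fin.last l) = ⊤
  ear : ∀ i : Fin l, ∃ (a b : V) (p : G.Walk a b),
    p.IsPath ∧ Odd p.length ∧
    a ∈ (Gs i.castSucc).verts ∧ b ∈ (Gs i.castSucc).verts ∧
    (∀ w ∈ p.support, w ≠ a → w ≠ b → w ∉ (Gs i.castSucc).verts) ∧
    (∀ e ∈ p.edges, e ∉ (Gs i.castSucc).edgeSet) ∧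
    Gs i.succ = Gs i.castSucc ⊔ p.toSubgraph

/-- A perfect matching `M` of `G` is absolute in an odd ear decomposition if its
restriction to each `G_i` is a perfect matching of `G_i`. -/
def AbsoluteIn {G : SimpleGraph V} (M : G.Subgraph) (D : OddEarDecomp G) : Prop :=
  ∀ i : Fin (D.l + 1), ∀ v ∈ (D.Gs i).verts, ∃! w : V, M.Adj v w ∧ (D.Gs i).Adj v w

/-- The set `V_3(K)` of vertices of degree 3 in the subgraph `K`. -/
def deg3 {G : SimpleGraph V} (K : G.Subgraph) : Set V :=
  {v | (K.neighborSet v).ncard = 3}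

/-- A member of `P(K)`: a path of `K` whose end vertices have degree 3 in `K` and all of
whose internal vertices have degree 2 in `K`. -/
def IsEarPath {G : SimpleGraph V} (K : G.Subgraph) {u v : V} (p : G.Walk u v) : Prop :=
  p.IsPath ∧ 0 < p.length ∧ (∀ e ∈ p.edges, e ∈ K.edgeSet) ∧
  u ∈ deg3 K ∧ v ∈ deg3 K ∧
  ∀ w ∈ p.support, w ≠ u → w ≠ v → (K.neighborSet w).ncard = 2

/-- A `(K, M)`-ear square graph (for `K` one of the graphs `G_i` of an ear decomposition):
each vertex `v` of degree 3 in `K` is replaced by a square `s_v` on `{v} × ZMod 4` (all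
other vertices of the ambient type are isolated), and each path `p(u,v) ∈ P(K)` is
replaced by its projected path `pr p`, a set of two edges forming, together with a
supporting edge in each of `s_u`, `s_v`, a copy of `K_{2,2}`; projected paths of distinct
paths are disjoint; and for every `v ∈ V_3(K)`, the two paths at `v` other than the
matching-path of `v` have vertex-disjoint supporting edges in `s_v`. -/
structure EarSquareGraph (G : SimpleGraph V) (K : G.Subgraph) (M : Set (Sym2 V)) where
  Q : SimpleGraph (V × ZMod 4)
  pr : ∀ {u v : V}, G.Walk u v → Set (Sym2 (V × ZMod 4))
  bip : Q.Colorable 2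
  isolated : ∀ (v : V) (j : ZMod 4) (q : V × ZMod 4), v ∉ deg3 K → ¬Q.Adj (v, j) q
  intra : ∀ v ∈ deg3 K, ∀ j k : ZMod 4, Q.Adj (v, j) (v, k) ↔ (k = j + 1 ∨ j = k + 1)
  pr_symm : ∀ {u v : V} (p : G.Walk u v), pr p.reverse = pr p
  pr_shape : ∀ {u v : V} (p : G.Walk u v), IsEarPath K p → ∃ j k : ZMod 4,
    pr p = {s((u, j), (v, k)), s((u, j + 1), (v, k + 1))} ∨
    pr p = {s((u, j), (v, k)), s((u, j + 1), (v, k + 3))}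
  pr_disjoint : ∀ {u v u' v' : V} (p : G.Walk u v) (q : G.Walk u' v'),
    IsEarPath K p → IsEarPath K q →
    (⟨u, v, p⟩ : Σ a b : V, G.Walk a b) ≠ ⟨u', v', q⟩ →
    (⟨u, v, p⟩ : Σ a b : V, G.Walk a b) ≠ ⟨v', u', q.reverse⟩ →
    Disjoint (pr p) (pr q)
  inter : ∀ (u v : V) (j k : ZMod 4), u ≠ v →
    (Q.Adj (u, j) (v, k) ↔ ∃ p : G.Walk u v, IsEarPath K p ∧ s((u, j), (v, k)) ∈ pr p)
  matched : ∀ (v y z : V) (q : G.Walk v y) (r : G.Walk v z),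
    IsEarPath K q → IsEarPath K r → q.getVert 1 ≠ r.getVert 1 →
    (∀ w : V, s(v, w) ∈ M → q.getVert 1 ≠ w ∧ r.getVert 1 ≠ w) →
    Disjoint (sqSupp v (pr q)) (sqSupp v (pr r))

/-- A fixed-point-free involution moving every vertex to a neighbor gives a perfect matching. -/
theorem exists_isPerfectMatching_of_involutive {W : Type*} (H : SimpleGraph W) (f : W → W)
    (hf : Function.Involutive f) (hadj : ∀ x, H.Adj x (f x)) (a b : W) :
    ∃ M : H.Subgraph, M.IsPerfectMatching ∧ s(a, f a) ∈ M.edgeSet ∧ s(b, f b) ∈ M.edgeSet := by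
  refine ⟨{ verts := Set.univ
            Adj := fun x y => f x = y
            adj_sub := ?_
            edge_vert := fun _ => Set.mem_univ _
            symm := ?_ }, ?_, ?_, ?_⟩
  · rintro x _ rfl
    exact hadj x
  · refine ⟨?_⟩
    rintro x _ rfl
    exact hf x
  · rw [Subgraph.isPerfectMatching_iff]
    exact fun x => ⟨f x, rfl, fun y hy => Eq.symm hy⟩
  · simp
  · simp

/-- Adjacency inside a hexagon: the two vertices lie in different classes `X`, `Y`. -/
def OppositeClass (i j : ZMod 6) : Prop := i.val % 2 ≠ j.val % 2

instance : DecidableRel OppositeClass := fun i j => by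
  unfold OppositeClass
  infer_instance

/-- Adjacency along white edges. -/
def WhiteAdj {V : Type} (G : SimpleGraph V) (idx : V → V → ZMod 6) (p q : V × ZMod 6) : Prop :=
  G.Adj p.1 q.1 ∧ (p.2 = idx p.1 q.1 ∨ p.2 = idx p.1 q.1 + 3) ∧
    (q.2 = idx q.1 p.1 ∨ q.2 = idx q.1 p.1 + 3) ∧ OppositeClass p.2 q.2

/-- The other end of the red edge at a vertex. -/
def redMate {V : Type} (p : V × ZMod 6) : V × ZMod 6 := (p.1, p.2 + 3)

/-- The six perfect matchings of a hexagon, as involutions. -/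
def hexagonMate (k : Fin 6) (i : ZMod 6) : ZMod 6 :=
  match k with
  | 0 => 1 - i
  | 1 => 3 - i
  | 2 => 5 - i
  | 3 => i + 3
  | 4 => if i.val % 2 = 0 then i + 1 else i - 1
  | 5 => if i.val % 2 = 0 then i - 1 else i + 1

theorem hexagonMate_hexagonMate (k : Fin 6) (i : ZMod 6) :
    hexagonMate k (hexagonMate k i) = i := by
  revert k i
  decide

theorem oppositeClass_hexagonMate (k : Fin 6) (i : ZMod 6) :
    OppositeClass i (hexagonMate k i) := by
  revert k i
  decide

theorem exists_hexagonMate_eq {a b : ZMod 6} (h : OppositeClass a b) :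
    ∃ k, hexagonMate k a = b := by
  revert a b
  decide

set_option maxRecDepth 100000 in
set_option synthInstance.maxSize 1000 in
theorem exists_hexagonMate_eq_and_eq {a b c d : ZMod 6} (hab : OppositeClass a b)
    (hcd : OppositeClass c d) (hac : a ≠ c) (had : a ≠ d) (hbc : b ≠ c) (hbd : b ≠ d) :
    ∃ k, hexagonMate k a = b ∧ hexagonMate k c = d := by
  have key : ∀ a b c d : ZMod 6, OppositeClass a b → OppositeClass c d → a ≠ c → a ≠ d →
      b ≠ c → b ≠ d → ∃ k, hexagonMate k a = b ∧ hexagonMate k c = d := by decide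
  exact key a b c d hab hcd hac had hbc hbd

theorem OppositeClass.symm {i j : ZMod 6} (h : OppositeClass i j) : OppositeClass j i :=
  Ne.symm h

theorem oppositeClass_add_three (i : ZMod 6) : OppositeClass i (i + 3) := by
  revert i
  decide

theorem OppositeClass.add_three {i j : ZMod 6} (h : OppositeClass i j) :
    OppositeClass (i + 3) (j + 3) := by
  revert i j
  decide

theorem oppositeClass_iff (i j : ZMod 6) :
    OppositeClass i j ↔ (j = i + 1 ∨ j = i + 3) ∨ (i = j + 1 ∨ i = j + 3) := by
  revert i j
  decide

theorem add_three_add_three (i : ZMod 6) : i + 3 + 3 = i := by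
  revert i
  decide

theorem redMate_redMate {V : Type} (p : V × ZMod 6) : redMate (redMate p) = p := by
  simp [redMate, add_three_add_three]

section

variable {V : Type} {G : SimpleGraph V} {idx : V → V → ZMod 6}

theorem WhiteAdj.symm {p q : V × ZMod 6} (h : WhiteAdj G idx p q) : WhiteAdj G idx q p :=
  ⟨h.1.symm, h.2.2.1, h.2.1, h.2.2.2.symm⟩

theorem WhiteAdj.redMate {p q : V × ZMod 6} (h : WhiteAdj G idx p q) :
    WhiteAdj G idx (redMate p) (redMate q) := by
  obtain ⟨h₁, h₂, h₃, h₄⟩ := h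
  refine ⟨h₁, ?_, ?_, h₄.add_three⟩
  · rcases h₂ with h | h <;> simp [Hex.redMate, h, add_three_add_three]
  · rcases h₃ with h | h <;> simp [Hex.redMate, h, add_three_add_three]

theorem eq_or_add_three_and_oppositeClass_iff (a b : ZMod 6) (i j : ZMod 6) :
    ((i = a ∨ i = a + 3) ∧ (j = b ∨ j = b + 3) ∧ OppositeClass i j) ↔
      if a.val % 2 = b.val % 2 then (i = a ∧ j = b + 3) ∨ (i = a + 3 ∧ j = b)
      else (i = a ∧ j = b) ∨ (i = a + 3 ∧ j = b + 3) := by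
  revert a b i j
  decide

theorem whiteAdj_iff_whitePairs (p q : V × ZMod 6) :
    WhiteAdj G idx p q ↔ G.Adj p.1 q.1 ∧
      (s(p, q) = (whitePairs idx p.1 q.1).1 ∨ s(p, q) = (whitePairs idx p.1 q.1).2) := by
  obtain ⟨u, i⟩ := p
  obtain ⟨v, j⟩ := q
  unfold WhiteAdj
  refine and_congr_right fun h => ?_
  have huv : u ≠ v := h.ne
  rw [eq_or_add_three_and_oppositeClass_iff, whitePairs]
  split_ifs <;> simp [huv]

theorem isWhite_iff (p q : V × ZMod 6) : IsWhite G idx s(p, q) ↔ WhiteAdj G idx p q := by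
  constructor
  · rintro ⟨u, v, huv, h⟩
    have key : ∀ i j : ZMod 6, s(p, q) = s((u, i), (v, j)) →
        WhiteAdj G idx (u, i) (v, j) → WhiteAdj G idx p q := by
      intro i j hs hw
      rcases Sym2.eq_iff.1 hs with ⟨rfl, rfl⟩ | ⟨rfl, rfl⟩
      · exact hw
      · exact hw.symm
    rcases h with h | h
    all_goals
      unfold whitePairs at h
      split_ifs at h with hc
      all_goals
        refine key _ _ h ((whiteAdj_iff_whitePairs _ _).2 ⟨huv, ?_⟩)
        simp [whitePairs, hc]
  · intro h
    exact ⟨_, _, (whiteAdj_iff_whitePairs _ _).1 h⟩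

theorem hexagonGraph_adj_iff (p q : V × ZMod 6) :
    (hexagonGraph G idx).Adj p q ↔
      (p.1 = q.1 ∧ OppositeClass p.2 q.2) ∨ WhiteAdj G idx p q := by
  have hne : WhiteAdj G idx p q → p ≠ q := by
    rintro h rfl
    exact h.1.ne rfl
  have hne' : OppositeClass p.2 q.2 → p ≠ q := by
    rintro h rfl
    exact h rfl
  have hsymm : WhiteAdj G idx q p → WhiteAdj G idx p q := WhiteAdj.symm
  rw [hexagonGraph, fromRel_adj, isWhite_iff, isWhite_iff]
  rw [oppositeClass_iff] at *
  grind

theorem exists_neighbor_idx (hG : IsCubic G) (hidx : GoodIdx G idx) (v : V) (a : ZMod 6)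
    (ha : a.val < 3) : ∃ u, G.Adj v u ∧ idx v u = a := by
  have hinj : Set.InjOn (idx v) (G.neighborSet v) := by
    intro u hu w hw h
    by_contra hne
    exact hidx.2 v u w hu hw hne h
  have hcard : {i : ZMod 6 | i.val < 3}.ncard = 3 := by
    rw [Set.ncard_eq_toFinset_card']
    decide
  have himage : idx v '' G.neighborSet v = {i : ZMod 6 | i.val < 3} := by
    refine Set.eq_of_subset_of_ncard_le ?_ ?_ (Set.toFinite _)
    · rintro _ ⟨u, hu, rfl⟩
      exact hidx.1 v u hu
    · rw [hinj.ncard_image, hG v, hcard]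
  have hmem : a ∈ idx v '' G.neighborSet v := himage ▸ ha
  exact hmem

theorem exists_whiteAdj (hG : IsCubic G) (hidx : GoodIdx G idx) (p : V × ZMod 6) :
    ∃ q, WhiteAdj G idx p q := by
  obtain ⟨v, i⟩ := p
  have h : ∃ u, G.Adj v u ∧ (i = idx v u ∨ i = idx v u + 3) := by
    by_cases hi : i.val < 3
    · obtain ⟨u, hu, rfl⟩ := exists_neighbor_idx hG hidx v i hi
      exact ⟨u, hu, Or.inl rfl⟩
    · have hi' : (i + 3).val < 3 := by
        revert i
        decide
      obtain ⟨u, hu, h⟩ := exists_neighbor_idx hG hidx v (i + 3) hi'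
      exact ⟨u, hu, Or.inr (by rw [h, add_three_add_three])⟩
  obtain ⟨u, hu, h⟩ := h
  have hclass : ∀ i b : ZMod 6, OppositeClass i b ∨ OppositeClass i (b + 3) := by decide
  rcases hclass i (idx u v) with hb | hb
  · exact ⟨(u, idx u v), hu, h, Or.inl rfl, hb⟩
  · exact ⟨(u, idx u v + 3), hu, h, Or.inr rfl, hb⟩

theorem WhiteAdj.unique (hidx : GoodIdx G idx) {p q r : V × ZMod 6}
    (hq : WhiteAdj G idx p q) (hr : WhiteAdj G idx p r) : q = r := by
  obtain ⟨v, i⟩ := p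
  obtain ⟨u, j⟩ := q
  obtain ⟨w, k⟩ := r
  obtain ⟨hq₁, hq₂, hq₃, hq₄⟩ := hq
  obtain ⟨hr₁, hr₂, hr₃, hr₄⟩ := hr
  dsimp only at *
  have hsame : ∀ i a b : ZMod 6, a.val < 3 → b.val < 3 → (i = a ∨ i = a + 3) →
      (i = b ∨ i = b + 3) → a = b := by decide
  have huw : u = w := by
    by_contra hne
    exact hidx.2 v u w hq₁ hr₁ hne
      (hsame i _ _ (hidx.1 _ _ hq₁) (hidx.1 _ _ hr₁) hq₂ hr₂)
  subst huw
  have hclass : ∀ i j k b : ZMod 6, (j = b ∨ j = b + 3) → (k = b ∨ k = b + 3) →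
      OppositeClass i j → OppositeClass i k → j = k := by decide
  rw [hclass i j k _ hq₃ hr₃ hq₄ hr₄]

theorem exists_whiteMate (hG : IsCubic G) (hidx : GoodIdx G idx) :
    ∃ f : V × ZMod 6 → V × ZMod 6, ∀ p q, WhiteAdj G idx p q ↔ f p = q := by
  choose f hf using exists_whiteAdj hG hidx
  refine ⟨f, fun p q => ⟨fun h => (hf p).unique hidx h, ?_⟩⟩
  rintro rfl
  exact hf p

theorem exists_isPerfectMatching_of_red_white (hG : IsCubic G) (hidx : GoodIdx G idx)
    {x y z : V × ZMod 6} (hxy : WhiteAdj G idx x y) (hzx : z ≠ x) (hzy : z ≠ y)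
    (hzx' : redMate z ≠ x) (hzy' : redMate z ≠ y) :
    ∃ M : (hexagonGraph G idx).Subgraph,
      M.IsPerfectMatching ∧ s(z, redMate z) ∈ M.edgeSet ∧ s(x, y) ∈ M.edgeSet := by
  classical
  obtain ⟨f, hf⟩ := exists_whiteMate hG hidx
  have hff : ∀ p, f (f p) = p := fun p => (hf _ _).1 ((hf _ _).2 rfl).symm
  have hfr : ∀ p, f (redMate p) = redMate (f p) := fun p =>
    (hf _ _).1 ((hf _ _).2 rfl).redMate
  have hrr : ∀ p : V × ZMod 6, redMate (redMate p) = p := redMate_redMate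
  obtain rfl := (hf x y).1 hxy
  let S : Set (V × ZMod 6) := {x, redMate x, f x, redMate (f x)}
  have hS : ∀ p, p ∈ S ↔ p = x ∨ p = redMate x ∨ p = f x ∨ p = redMate (f x) := fun p => by
    simp [S]
  let g : V × ZMod 6 → V × ZMod 6 := fun p => if p ∈ S then f p else redMate p
  have hfS : ∀ p ∈ S, f p ∈ S := by
    intro p hp
    rw [hS] at hp ⊢
    rcases hp with rfl | rfl | rfl | rfl <;> simp [hff, hfr]
  have hrS : ∀ p, redMate p ∈ S → p ∈ S := by
    intro p hp
    rw [← hrr p]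
    generalize redMate p = q at hp
    rw [hS] at hp ⊢
    rcases hp with rfl | rfl | rfl | rfl <;> simp [hrr]
  have hgg : Function.Involutive g := by
    intro p
    by_cases hp : p ∈ S
    · simp [g, hp, hfS p hp, hff]
    · have hp' : redMate p ∉ S := fun h => hp (hrS p h)
      simp [g, hp, hp', hrr]
  have hadj : ∀ p, (hexagonGraph G idx).Adj p (g p) := by
    intro p
    rw [hexagonGraph_adj_iff]
    by_cases hp : p ∈ S
    · right
      simp [g, hp, hf]
    · left
      simp [g, hp, redMate, oppositeClass_add_three]
  have hz : z ∉ S := by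
    rw [hS]
    rintro (rfl | rfl | rfl | rfl)
    · exact hzx rfl
    · exact hzx' (hrr _)
    · exact hzy rfl
    · exact hzy' (hrr _)
  have hx : x ∈ S := by simp [S]
  have h := exists_isPerfectMatching_of_involutive _ g hgg hadj z x
  simpa only [g, hz, hx, if_true, if_false] using h

theorem exists_isPerfectMatching_of_white_white (hG : IsCubic G) (hidx : GoodIdx G idx)
    {p q r s : V × ZMod 6} (hpq : WhiteAdj G idx p q) (hrs : WhiteAdj G idx r s) :
    ∃ M : (hexagonGraph G idx).Subgraph,
      M.IsPerfectMatching ∧ s(p, q) ∈ M.edgeSet ∧ s(r, s) ∈ M.edgeSet := by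
  obtain ⟨f, hf⟩ := exists_whiteMate hG hidx
  obtain rfl := (hf p q).1 hpq
  obtain rfl := (hf r s).1 hrs
  refine exists_isPerfectMatching_of_involutive _ f (fun p => ?_) (fun p => ?_) p r
  · exact (hf _ _).1 ((hf _ _).2 rfl).symm
  · exact (hexagonGraph_adj_iff _ _).2 (Or.inr ((hf _ _).2 rfl))

theorem exists_isPerfectMatching_of_hexagon_hexagon {v w : V} {a b c d : ZMod 6}
    (hab : OppositeClass a b) (hcd : OppositeClass c d)
    (hdisj : v = w → a ≠ c ∧ a ≠ d ∧ b ≠ c ∧ b ≠ d) :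
    ∃ M : (hexagonGraph G idx).Subgraph,
      M.IsPerfectMatching ∧ s((v, a), (v, b)) ∈ M.edgeSet ∧
        s((w, c), (w, d)) ∈ M.edgeSet := by
  classical
  obtain ⟨K, hv, hw⟩ : ∃ K : V → Fin 6, hexagonMate (K v) a = b ∧ hexagonMate (K w) c = d := by
    by_cases hvw : v = w
    · subst hvw
      obtain ⟨h₁, h₂, h₃, h₄⟩ := hdisj rfl
      obtain ⟨k, hk⟩ := exists_hexagonMate_eq_and_eq hab hcd h₁ h₂ h₃ h₄
      exact ⟨fun _ => k, hk⟩
    · obtain ⟨k, hk⟩ := exists_hexagonMate_eq hab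
      obtain ⟨l, hl⟩ := exists_hexagonMate_eq hcd
      refine ⟨fun x => if x = v then k else l, ?_, ?_⟩
      · simpa using hk
      · simpa [Ne.symm hvw] using hl
  subst hv hw
  refine exists_isPerfectMatching_of_involutive _
    (fun p => (p.1, hexagonMate (K p.1) p.2)) (fun p => ?_) (fun p => ?_) (v, a) (w, c)
  · simp [hexagonMate_hexagonMate]
  · exact (hexagonGraph_adj_iff _ _).2 (Or.inl ⟨rfl, oppositeClass_hexagonMate _ _⟩)

theorem isBlue_or_eq_add_three (v : V) {a b : ZMod 6} (h : OppositeClass a b) :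
    IsBlue s((v, a), (v, b)) ∨ b = a + 3 := by
  rcases (oppositeClass_iff a b).1 h with (rfl | rfl) | (rfl | rfl)
  · exact Or.inl ⟨v, a, rfl⟩
  · exact Or.inr rfl
  · exact Or.inl ⟨v, b, Sym2.eq_swap⟩
  · exact Or.inr (add_three_add_three b).symm

end

/-- every pair of vertex-disjoint edges of the hexagon graph that does not
consist of one blue and one white edge is contained in a perfect matching. -/
theorem stmt11 {V : Type} [Fintype V] [DecidableEq V] (G : SimpleGraph V)
    (hG : IsCubic G) (idx : V → V → ZMod 6) (hidx : GoodIdx G idx) :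
    ∀ e₁ ∈ (hexagonGraph G idx).edgeSet, ∀ e₂ ∈ (hexagonGraph G idx).edgeSet,
      (∀ x ∈ e₁, x ∉ e₂) →
      ¬((IsBlue e₁ ∧ IsWhite G idx e₂) ∨ (IsWhite G idx e₁ ∧ IsBlue e₂)) →
      ∃ M : (hexagonGraph G idx).Subgraph,
        M.IsPerfectMatching ∧ e₁ ∈ M.edgeSet ∧ e₂ ∈ M.edgeSet := by
  rintro ⟨⟨v, a⟩, ⟨v', b⟩⟩ h₁ ⟨⟨w, c⟩, ⟨w', d⟩⟩ h₂ hdisj hcol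
  change s((v, a), (v', b)) ∈ _ at h₁
  change s((w, c), (w', d)) ∈ _ at h₂
  change ∀ x ∈ s((v, a), (v', b)), x ∉ s((w, c), (w', d)) at hdisj
  change ¬((IsBlue s((v, a), (v', b)) ∧ IsWhite G idx s((w, c), (w', d))) ∨
    (IsWhite G idx s((v, a), (v', b)) ∧ IsBlue s((w, c), (w', d)))) at hcol
  change ∃ M : (hexagonGraph G idx).Subgraph, M.IsPerfectMatching ∧
    s((v, a), (v', b)) ∈ M.edgeSet ∧ s((w, c), (w', d)) ∈ M.edgeSet
  rw [mem_edgeSet, hexagonGraph_adj_iff] at h₁ h₂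
  rw [isWhite_iff, isWhite_iff, not_or, not_and, not_and] at hcol
  simp only [Sym2.mem_iff, forall_eq_or_imp, forall_eq, not_or] at hdisj
  obtain ⟨⟨hac, had⟩, hbc, hbd⟩ := hdisj
  rcases h₁ with ⟨hv, hab⟩ | hab <;> rcases h₂ with ⟨hw, hcd⟩ | hcd
  · dsimp only at hv hw
    subst hv hw
    refine exists_isPerfectMatching_of_hexagon_hexagon hab hcd ?_
    rintro rfl
    simp_all
  · dsimp only at hv
    subst hv
    obtain rfl := (isBlue_or_eq_add_three v hab).resolve_left fun h => hcol.1 h hcd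
    exact exists_isPerfectMatching_of_red_white hG hidx hcd hac had hbc hbd
  · dsimp only at hw
    subst hw
    obtain rfl := (isBlue_or_eq_add_three w hcd).resolve_left (hcol.2 hab)
    obtain ⟨M, hM, h, h'⟩ := exists_isPerfectMatching_of_red_white hG hidx hab
      (Ne.symm hac) (Ne.symm hbc) (Ne.symm had) (Ne.symm hbd)
    exact ⟨M, hM, h', h⟩
  · exact exists_isPerfectMatching_of_white_white hG hidx hab hcd

end Hex
end

section
/- Let G be a finite simple cubic bridgeless graph, M a perfect matching of G, and Q an M-square graph of G. Then there is a sequence of bipartite graphs H_0, H_1, …, H_l such that H_0 = Q, H_i is obtained from H_{i-1} by a simple augmentation for each i ∈ {1, …, l}, and H_l is a hexagon graph of G. -/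
open SimpleGraph

namespace Hex

variable {V : Type}

/-- A simple augmentation whose result is bipartite. -/
def AugStep (A B : BundledGraph) : Prop :=
  IsSimpleAug A B ∧ B.graph.Colorable 2

/-- Some sequence of bipartite simple augmentations leads from `A` to a graph isomorphic to
the restriction of `K` to `S`. -/
def Reaches {W : Type} (A : BundledGraph) (K : SimpleGraph W) (S : Set W) : Prop :=
  ∃ B : BundledGraph, Relation.ReflTransGen AugStep A B ∧
    ∃ f : B.graph ↪g K, Set.range f = S

lemma exists_sequence {A B : BundledGraph} (h : Relation.ReflTransGen AugStep A B) :
    ∃ (k : ℕ) (Hs : ℕ → BundledGraph), Hs 0 = A ∧ Hs k = B ∧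
      ∀ i < k, AugStep (Hs i) (Hs (i + 1)) := by
  induction h with
  | refl => exact ⟨0, fun _ => A, rfl, rfl, by simp⟩
  | @tail B C _ hBC ih =>
    obtain ⟨k, Hs, h0, hk, hs⟩ := ih
    refine ⟨k + 1, fun i => if i ≤ k then Hs i else C, by simp [h0], by simp, ?_⟩
    intro i hi
    rcases Nat.lt_or_ge i k with h | h
    · have h1 : i ≤ k := h.le
      have h2 : i + 1 ≤ k := h
      simpa [h1, h2] using hs i h
    · obtain rfl : i = k := by omega
      simpa [hk] using hBC

lemma colorable_two_of_bool {α : Type} {H : SimpleGraph α} (c : α → Bool)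
    (hc : ∀ a b, H.Adj a b → c a ≠ c b) : H.Colorable 2 := by
  have := (SimpleGraph.Coloring.mk c (fun {a b} h => hc a b h)).colorable
  simpa using this

/-- The graph `K` with the edge `xy` added. -/
def addEdge {W : Type} (K : SimpleGraph W) (x y : W) : SimpleGraph W :=
  SimpleGraph.fromRel fun a b => K.Adj a b ∨ (a = x ∧ b = y)

/-- The expansion of `x` in `K` to `b t x`, where the neighbors `n₁`, `n₂` of `x` become
neighbors of `b`, together with the new edge `tw`. -/
def expandVertex {W : Type} (K : SimpleGraph W) (x w n₁ n₂ t b : W) : SimpleGraph W :=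
  SimpleGraph.fromRel fun p q =>
    (K.Adj p q ∧ ¬(p = x ∧ (q = n₁ ∨ q = n₂)) ∧ ¬(q = x ∧ (p = n₁ ∨ p = n₂))) ∨
    (p = b ∧ (q = n₁ ∨ q = n₂)) ∨ (p = t ∧ (q = x ∨ q = b ∨ q = w))

lemma addEdge_adj {W : Type} {K : SimpleGraph W} {x y a b : W} (hxy : x ≠ y) :
    (addEdge K x y).Adj a b ↔ K.Adj a b ∨ (a = x ∧ b = y) ∨ (a = y ∧ b = x) := by
  have := K.adj_comm a b
  have : K.Adj a b → a ≠ b := fun h => h.ne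
  simp only [addEdge, SimpleGraph.fromRel_adj]
  grind

lemma Reaches.addEdge {W : Type} {A : BundledGraph} {K : SimpleGraph W} {S : Set W}
    (col : W → Bool) (hcol : ∀ a b, K.Adj a b → col a ≠ col b) {x y : W}
    (hx : x ∈ S) (hy : y ∈ S) (hxy : col x ≠ col y) (h : Reaches A K S) :
    Reaches A (addEdge K x y) S := by
  have hne : x ≠ y := fun h => hxy (by rw [h])
  obtain ⟨B, hB, f, hf⟩ := h
  by_cases hadj : K.Adj x y
  · have : Hex.addEdge K x y = K := by
      ext a b
      have := hadj.symm
      rw [addEdge_adj hne]; grind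
    rw [this]; exact ⟨B, hB, f, hf⟩
  · subst hf
    obtain ⟨x, rfl⟩ := hx
    obtain ⟨y, rfl⟩ := hy
    have key : ∀ a b, (SimpleGraph.fromEdgeSet (insert s(x, y) B.graph.edgeSet)).Adj a b ↔
        (Hex.addEdge K (f x) (f y)).Adj (f a) (f b) := by
      intro a b
      rw [addEdge_adj hne, f.map_adj_iff]
      simp only [SimpleGraph.fromEdgeSet_adj, Set.mem_insert_iff, Sym2.eq_iff,
        SimpleGraph.mem_edgeSet, f.injective.eq_iff]
      have : B.graph.Adj a b → a ≠ b := fun h => h.ne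
      have : x ≠ y := fun h => hne (by rw [h])
      grind
    have hcol' : (SimpleGraph.fromEdgeSet (insert s(x, y) B.graph.edgeSet)).Colorable 2 := by
      refine colorable_two_of_bool (fun a => col (f a)) fun a b h => ?_
      rw [key, addEdge_adj hne] at h
      rcases h with h | ⟨h1, h2⟩ | ⟨h1, h2⟩
      · exact hcol _ _ h
      · rw [h1, h2]; exact hxy
      · rw [h1, h2]; exact hxy.symm
    refine ⟨⟨B.carrier, SimpleGraph.fromEdgeSet (insert s(x, y) B.graph.edgeSet)⟩,
      hB.tail ⟨Or.inl ⟨x, y, fun h => hne (by rw [h]), fun h => hadj (f.map_adj_iff.2 h), hcol',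
        ⟨Iso.refl⟩⟩, hcol'⟩, ⟨f.toEmbedding, ?_⟩, rfl⟩
    intro a b
    exact (key a b).symm

lemma expandVertex_adj {W : Type} {K : SimpleGraph W} {x w n₁ n₂ t b p q : W}
    (h1 : b ≠ n₁) (h2 : b ≠ n₂) (h3 : t ≠ x) (h4 : t ≠ b) (h5 : t ≠ w) :
    (expandVertex K x w n₁ n₂ t b).Adj p q ↔
      (K.Adj p q ∧ ¬(p = x ∧ (q = n₁ ∨ q = n₂)) ∧ ¬(q = x ∧ (p = n₁ ∨ p = n₂))) ∨
      (p = b ∧ (q = n₁ ∨ q = n₂)) ∨ (q = b ∧ (p = n₁ ∨ p = n₂)) ∨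
      (p = t ∧ (q = x ∨ q = b ∨ q = w)) ∨ (q = t ∧ (p = x ∨ p = b ∨ p = w)) := by
  have := K.adj_comm p q
  have : K.Adj p q → p ≠ q := fun h => h.ne
  simp only [expandVertex, SimpleGraph.fromRel_adj]
  grind

lemma Reaches.expandVertex {W : Type} [Finite W] {A : BundledGraph} {K : SimpleGraph W}
    {S : Set W} (col : W → Bool) (hcol : ∀ a b, K.Adj a b → col a ≠ col b)
    (hS : ∀ a b, K.Adj a b → a ∈ S) {x w n₁ n₂ n₃ n₄ t b : W}
    (h₁ : K.Adj x n₁) (h₂ : K.Adj x n₂) (h₃ : K.Adj x n₃) (h₄ : K.Adj x n₄)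
    (h₁₂ : n₁ ≠ n₂) (h₁₃ : n₁ ≠ n₃) (h₁₄ : n₁ ≠ n₄) (h₂₃ : n₂ ≠ n₃) (h₂₄ : n₂ ≠ n₄)
    (h₃₄ : n₃ ≠ n₄) (hw : w ∈ S) (hwx : w ≠ x) (hcw : col w = col x)
    (ht : t ∉ S) (hb : b ∉ S) (hct : col t ≠ col x) (hcb : col b = col x)
    (h : Reaches A K S) :
    Reaches A (expandVertex K x w n₁ n₂ t b) (insert t (insert b S)) := by
  classical
  obtain ⟨B, hB, f, rfl⟩ := h
  obtain ⟨x, rfl⟩ := hS _ _ h₁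
  obtain ⟨n₁, rfl⟩ := hS _ _ h₁.symm
  obtain ⟨n₂, rfl⟩ := hS _ _ h₂.symm
  obtain ⟨n₃, rfl⟩ := hS _ _ h₃.symm
  obtain ⟨n₄, rfl⟩ := hS _ _ h₄.symm
  obtain ⟨w, rfl⟩ := hw
  have htf : ∀ a, f a ≠ t := fun a h => ht ⟨a, h⟩
  have hbf : ∀ a, f a ≠ b := fun a h => hb ⟨a, h⟩
  have htb : t ≠ b := fun h => hct (by rw [h, hcb])
  have : Finite B.carrier := Finite.of_injective f f.injective
  rw [f.map_adj_iff] at h₁ h₂ h₃ h₄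
  rw [f.injective.ne_iff] at h₁₂ h₁₃ h₁₄ h₂₃ h₂₄ h₃₄ hwx
  set K' := Hex.expandVertex K (f x) (f w) (f n₁) (f n₂) t b
  have hK'adj : ∀ p q, K'.Adj p q ↔ _ := fun p q =>
    expandVertex_adj (hbf n₁).symm (hbf n₂).symm (htf x).symm htb (htf w).symm
  let g : B.carrier ⊕ Fin 2 → W := fun p => match p with
    | Sum.inl a => if a = x then t else f a
    | Sum.inr i => if i = 0 then b else f x
  have hcolK' : ∀ a b, K'.Adj a b → col a ≠ col b := by
    intro p q hpq
    have e1 := hcol _ _ (f.map_adj_iff.2 h₁)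
    have e2 := hcol _ _ (f.map_adj_iff.2 h₂)
    rw [hK'adj] at hpq
    rcases hpq with h | h | h | h | h
    · exact hcol _ _ h.1
    all_goals grind
  have ginj : Function.Injective g := by
    have finj := f.injective
    rintro (a | i) (a' | i') hg
    · simp only [g] at hg
      grind [Function.Injective]
    · simp only [g] at hg
      grind [Function.Injective]
    · simp only [g] at hg
      grind [Function.Injective]
    · fin_cases i <;> fin_cases i' <;> simp [g] at hg ⊢
      · exact (hbf x) hg.symm
      · exact (hbf x) hg
  have grange : Set.range g = insert t (insert b (Set.range f)) := by
    ext p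
    simp only [Set.mem_range, Set.mem_insert_iff]
    constructor
    · rintro ⟨a | i, rfl⟩ <;> simp only [g] <;> grind
    · rintro (rfl | rfl | ⟨a, rfl⟩)
      · exact ⟨Sum.inl x, by simp [g]⟩
      · exact ⟨Sum.inr 0, by simp [g]⟩
      · by_cases ha : a = x
        · exact ⟨Sum.inr 1, by simp [g, ha]⟩
        · exact ⟨Sum.inl a, by simp [g, ha]⟩
  let C := SimpleGraph.fromEdgeSet
    (insert s(Sum.inl x, Sum.inl w) (expansion B.graph x {n₁, n₂}).edgeSet)
  have key : ∀ p q, K'.Adj (g p) (g q) ↔ C.Adj p q := by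
    have finj := fun a a' => @Function.Injective.eq_iff _ _ _ f.injective a a'
    intro p q
    rw [hK'adj]
    simp only [C, SimpleGraph.fromEdgeSet_adj, Set.mem_insert_iff, Sym2.eq_iff,
      SimpleGraph.mem_edgeSet, expansion, SimpleGraph.fromRel_adj]
    have hloop : ∀ a, ¬B.graph.Adj a a := fun a => B.graph.loopless.irrefl a
    have hsymm : ∀ a a', B.graph.Adj a a' → B.graph.Adj a' a := fun a a' h => h.symm
    have hn₁ : n₁ ≠ x := h₁.ne.symm
    have hn₂ : n₂ ≠ x := h₂.ne.symm
    have hKt : ∀ p, ¬K.Adj t p := fun p h => ht (hS _ _ h)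
    have hKb : ∀ p, ¬K.Adj b p := fun p h => hb (hS _ _ h)
    have hKt' : ∀ p, ¬K.Adj p t := fun p h => hKt p h.symm
    have hKb' : ∀ p, ¬K.Adj p b := fun p h => hKb p h.symm
    have hKf : ∀ a a', K.Adj (f a) (f a') ↔ B.graph.Adj a a' := fun a a' => f.map_adj_iff
    rcases p with a | i <;> rcases q with a' | i'
    · simp only [g]
      by_cases ha : a = x <;> by_cases ha' : a' = x <;>
        simp [ha, ha', hKt, hKt', hKf, finj] <;> grind
    · fin_cases i' <;> simp only [g] <;> by_cases ha : a = x <;>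
        simp [ha, hKt, hKb', hKf, finj] <;> grind
    · fin_cases i <;> simp only [g] <;> by_cases ha' : a' = x <;>
        simp [ha', hKt', hKb, hKf, finj] <;> grind
    · fin_cases i <;> fin_cases i' <;> simp [g, hKb, hKb', finj] <;> grind
  refine ⟨⟨_, C⟩, hB.tail ⟨Or.inr ⟨x, w, {n₁, n₂}, ?_, ?_, ?_, ?_, hwx, ?_, ⟨Iso.refl⟩⟩, ?_⟩,
    ⟨⟨g, ginj⟩, fun {p q} => key p q⟩, grange⟩
  · have : ({n₁, n₂, n₃, n₄} : Set B.carrier) ⊆ B.graph.neighborSet x := by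
      rintro a (rfl | rfl | rfl | rfl) <;> assumption
    calc 4 = ({n₁, n₂, n₃, n₄} : Set B.carrier).ncard := by
          rw [Set.ncard_insert_of_notMem, Set.ncard_insert_of_notMem, Set.ncard_pair h₃₄] <;>
            simp [*]
      _ ≤ _ := Set.ncard_le_ncard this
  · rintro a (rfl | rfl) <;> assumption
  · rw [Set.ncard_pair h₁₂]
  · have : ({n₃, n₄} : Set B.carrier) ⊆ B.graph.neighborSet x \ {n₁, n₂} := by
      rintro a (rfl | rfl)
      · exact ⟨h₃, by simp [h₁₃.symm, h₂₃.symm]⟩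
      · exact ⟨h₄, by simp [h₁₄.symm, h₂₄.symm]⟩
    calc 2 = ({n₃, n₄} : Set B.carrier).ncard := by rw [Set.ncard_pair h₃₄]
      _ ≤ _ := Set.ncard_le_ncard this
  · refine ⟨SimpleGraph.Coloring.mk (fun a => if col (f a) then 0 else 1) ?_, ?_⟩
    · intro a a' h
      have := hcol _ _ (f.map_adj_iff.2 h)
      grind
    · change (if col (f w) then (0 : Fin 2) else 1) = if col (f x) then 0 else 1
      rw [hcw]
  · exact colorable_two_of_bool (fun p => col (g p)) fun p q h => hcolK' _ _ ((key p q).2 h)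

/-- Two expansions followed by four edge additions replace the two edges `x₀z₁`, `x₁z₀` joining
two squares `x₀x₁y₀y₁`, `z₀z₁r₀r₁` by two new pairs `a₀a₁`, `b₀b₁` completing the squares to
hexagons that are joined by `a₀b₁`, `a₁b₀`. -/
lemma Reaches.splitPair {W : Type} [Finite W] {A : BundledGraph} {K K' : SimpleGraph W}
    {S S' : Set W} (col : W → Bool) (hcol : ∀ a b, K.Adj a b → col a ≠ col b)
    (hS : ∀ a b, K.Adj a b → a ∈ S) {x₀ x₁ y₀ y₁ z₀ z₁ r₀ r₁ o₀ o₁ a₀ a₁ b₀ b₁ : W}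
    (hxx : K.Adj x₀ x₁) (hx₀y : K.Adj x₀ y₁) (hx₁y : K.Adj x₁ y₀)
    (hx₀z : K.Adj x₀ z₁) (hx₁z : K.Adj x₁ z₀) (hx₀o : K.Adj x₀ o₀) (hx₁o : K.Adj x₁ o₁)
    (hy₀ : y₀ ∈ S) (hr₀ : r₀ ∈ S) (hr₁ : r₁ ∈ S)
    (hxy₀ : x₀ ≠ y₀) (hxy₁ : x₁ ≠ y₁) (hxz₀ : x₀ ≠ z₀) (hxz₁ : x₁ ≠ z₁)
    (hyz₀ : y₀ ≠ z₀) (hyz₁ : y₁ ≠ z₁) (hxo₀ : x₀ ≠ o₁) (hxo₁ : x₁ ≠ o₀)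
    (hyo₀ : y₀ ≠ o₁) (hyo₁ : y₁ ≠ o₀) (hzo₀ : z₀ ≠ o₁) (hzo₁ : z₁ ≠ o₀)
    (ha₀ : a₀ ∉ S) (ha₁ : a₁ ∉ S) (hb₀ : b₀ ∉ S) (hb₁ : b₁ ∉ S)
    (hab₀ : a₀ ≠ b₀) (hab₁ : a₁ ≠ b₁)
    (cx₀ : col x₀ = false) (cx₁ : col x₁ = true)
    (cr₀ : col r₀ = false) (cr₁ : col r₁ = true) (ca₀ : col a₀ = false) (ca₁ : col a₁ = true)
    (cb₀ : col b₀ = false) (cb₁ : col b₁ = true)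
    (hK' : ∀ p q, K'.Adj p q ↔
      (K.Adj p q ∧ ¬(p = x₀ ∧ q = z₁) ∧ ¬(q = x₀ ∧ p = z₁) ∧ ¬(p = x₁ ∧ q = z₀) ∧
        ¬(q = x₁ ∧ p = z₀)) ∨
      (p = b₀ ∧ (q = z₁ ∨ q = r₁ ∨ q = b₁)) ∨ (q = b₀ ∧ (p = z₁ ∨ p = r₁ ∨ p = b₁)) ∨
      (p = b₁ ∧ (q = z₀ ∨ q = r₀)) ∨ (q = b₁ ∧ (p = z₀ ∨ p = r₀)) ∨
      (p = a₀ ∧ (q = x₁ ∨ q = y₁ ∨ q = a₁ ∨ q = b₁)) ∨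
      (q = a₀ ∧ (p = x₁ ∨ p = y₁ ∨ p = a₁ ∨ p = b₁)) ∨
      (p = a₁ ∧ (q = x₀ ∨ q = y₀ ∨ q = b₀)) ∨ (q = a₁ ∧ (p = x₀ ∨ p = y₀ ∨ p = b₀)))
    (hS' : ∀ p, p ∈ S' ↔ p = a₀ ∨ p = a₁ ∨ p = b₀ ∨ p = b₁ ∨ p ∈ S)
    (h : Reaches A K S) : Reaches A K' S' := by
  have cy₁ : col y₁ = true := by have := hcol _ _ hx₀y; grind
  have cy₀ : col y₀ = false := by have := hcol _ _ hx₁y; grind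
  have cz₁ : col z₁ = true := by have := hcol _ _ hx₀z; grind
  have cz₀ : col z₀ = false := by have := hcol _ _ hx₁z; grind
  have co₀ : col o₀ = true := by have := hcol _ _ hx₀o; grind
  have co₁ : col o₁ = false := by have := hcol _ _ hx₁o; grind
  have hx₀ := hS _ _ hxx
  have hx₁ := hS _ _ hxx.symm
  have hy₁ := hS _ _ hx₀y.symm
  have hz₀ := hS _ _ hx₁z.symm
  have hz₁ := hS _ _ hx₀z.symm
  have ho₀ := hS _ _ hx₀o.symm
  have ho₁ := hS _ _ hx₁o.symm
  have r1 := h.expandVertex col hcol hS (w := y₀) (t := a₁) (b := b₀) hxx hx₀z hx₀y hx₀o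
    hxz₁ hxy₁ hxo₁ hyz₁.symm hzo₁ hyo₁ hy₀ hxy₀.symm (by grind) ha₁ hb₀ (by grind) (by grind)
  set K1 := Hex.expandVertex K x₀ y₀ x₁ z₁ a₁ b₀
  have e1 : ∀ p q, K1.Adj p q ↔ _ := fun p q =>
    expandVertex_adj (by grind) (by grind) (by grind) (by grind) (by grind)
  have c1 : ∀ p q, K1.Adj p q → col p ≠ col q := by
    intro p q h
    have := hcol p q
    rw [e1] at h
    grind
  have s1 : ∀ p q, K1.Adj p q → p ∈ insert a₁ (insert b₀ S) := by
    intro p q h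
    have := hS p q
    rw [e1] at h
    simp only [Set.mem_insert_iff]
    grind
  have hyS : y₁ ∈ insert a₁ (insert b₀ S) := by simp [hy₁]
  have r2 := r1.expandVertex col c1 s1 (x := x₁) (w := y₁) (n₁ := b₀) (n₂ := z₀) (n₃ := y₀)
    (n₄ := o₁) (t := a₀) (b := b₁)
    (by rw [e1]; grind) (by rw [e1]; grind) (by rw [e1]; grind) (by rw [e1]; grind)
    (by grind) (by grind) (by grind) hyz₀.symm hzo₀ hyo₀ hyS hxy₁.symm
    (by grind) (by simp only [Set.mem_insert_iff]; grind) (by simp only [Set.mem_insert_iff]; grind)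
    (by grind) (by grind)
  set K2 := Hex.expandVertex K1 x₁ y₁ b₀ z₀ a₀ b₁
  have e2 : ∀ p q, K2.Adj p q ↔ _ := fun p q =>
    expandVertex_adj (by grind) (by grind) (by grind) (by grind) (by grind)
  have c2 : ∀ p q, K2.Adj p q → col p ≠ col q := by
    intro p q h
    have := c1 p q
    rw [e2] at h
    grind
  have addCol : ∀ {L : SimpleGraph W} {x y : W}, (∀ p q, L.Adj p q → col p ≠ col q) →
      col x ≠ col y → ∀ p q, (Hex.addEdge L x y).Adj p q → col p ≠ col q := by
    intro L x y hL hxy p q h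
    rw [addEdge_adj (by grind)] at h
    have := hL p q
    grind
  have d1 : col x₀ ≠ col x₁ := by grind
  have d2 : col a₀ ≠ col a₁ := by grind
  have d3 : col b₀ ≠ col r₁ := by grind
  have d4 : col b₁ ≠ col r₀ := by grind
  have r6 := (((r2.addEdge col c2 (by simp [hx₀]) (by simp [hx₁]) d1).addEdge col
    (addCol c2 d1) (x := a₀) (y := a₁) (by simp) (by simp) d2).addEdge col
    (addCol (addCol c2 d1) d2) (x := b₀) (y := r₁) (by simp) (by simp [hr₁]) d3).addEdge col
    (addCol (addCol (addCol c2 d1) d2) d3) (x := b₁) (y := r₀) (by simp) (by simp [hr₀]) d4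
  convert r6 using 1
  · ext p q
    rw [addEdge_adj (by grind), addEdge_adj (by grind), addEdge_adj (by grind),
      addEdge_adj (by grind), e2, e1, hK']
    have n1 : ∀ p q, K.Adj p q → p ∈ S ∧ q ∈ S := fun p q h => ⟨hS _ _ h, hS _ _ h.symm⟩
    have := n1 p q
    clear r6 r2 r1 c1 c2 e1 e2 s1 addCol h hK' hS' hcol hS hyS n1
    have := hxx.symm
    constructor
    · rintro (h | ⟨rfl, rfl | rfl | rfl⟩ | ⟨rfl, rfl | rfl | rfl⟩ | ⟨rfl, rfl | rfl⟩ |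
        ⟨rfl, rfl | rfl⟩ | ⟨rfl, rfl | rfl | rfl | rfl⟩ | ⟨rfl, rfl | rfl | rfl | rfl⟩ |
        ⟨rfl, rfl | rfl | rfl⟩ | ⟨rfl, rfl | rfl | rfl⟩)
      all_goals grind (splits := 30)
    · rintro ((((((⟨h | h | h | h | h, h'⟩ | h | h | h | h) | h) | h) | h) | h))
      all_goals grind (splits := 30)
  · ext p
    rw [hS']
    simp only [Set.mem_insert_iff]
    tauto

/-- A perfect matching `mate` of a cubic graph `G`, together with a labelling of the two other
neighbors of each vertex `u` as `sel u c` and `oth u c`, for each color `c`. -/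
structure MateData (G : SimpleGraph V) where
  mate : V → V
  sel : V → Bool → V
  oth : V → Bool → V
  mate_mate : ∀ u, mate (mate u) = u
  adj_iff : ∀ u c w, G.Adj u w ↔ w = mate u ∨ w = sel u c ∨ w = oth u c
  sel_ne_mate : ∀ u c, sel u c ≠ mate u
  oth_ne_mate : ∀ u c, oth u c ≠ mate u
  sel_ne_oth : ∀ u c, sel u c ≠ oth u c

/-- The vertices of `stageGraph`: two vertices for each dart of `G`, except for the matching darts
at vertices outside `P`. -/
def stageVerts {G : SimpleGraph V} (D : MateData G) (P : Set V) : Set (V × V × Bool) :=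
  {x | G.Adj x.1 x.2.1 ∧ (x.2.1 = D.mate x.1 → x.1 ∈ P)}

/-- The graph in which the squares at the vertices of `P` have been turned into hexagons. -/
def stageGraph {G : SimpleGraph V} (D : MateData G) (P : Set V) :
    SimpleGraph (V × V × Bool) :=
  SimpleGraph.fromRel fun x y => x.2.2 ≠ y.2.2 ∧ x ∈ stageVerts D P ∧ y ∈ stageVerts D P ∧
    (x.1 = y.1 ∨ (y.1 = x.2.1 ∧ x.1 = y.2.1) ∨
      (x.1 ∉ P ∧ y.1 ∉ P ∧ y.1 = D.mate x.1 ∧ x.2.1 = D.sel x.1 x.2.2 ∧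
        y.2.1 = D.sel y.1 y.2.2))

lemma stageGraph_adj {G : SimpleGraph V} (D : MateData G) (P : Set V)
    {u w u' w' : V} {c c' : Bool} :
    (stageGraph D P).Adj (u, w, c) (u', w', c') ↔
      c ≠ c' ∧ (G.Adj u w ∧ (w = D.mate u → u ∈ P)) ∧
      (G.Adj u' w' ∧ (w' = D.mate u' → u' ∈ P)) ∧
      (u = u' ∨ (u' = w ∧ u = w') ∨
        (u ∉ P ∧ u' ∉ P ∧ u' = D.mate u ∧ w = D.sel u c ∧ w' = D.sel u' c')) := by
  have := D.mate_mate u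
  have := D.mate_mate u'
  simp only [stageGraph, stageVerts, SimpleGraph.fromRel_adj, Set.mem_ofPred_eq, Prod.mk.injEq,
    ne_eq]
  grind (splits := 30)

lemma Reaches.stage_insert {V : Type} [Finite V] {A : BundledGraph} {G : SimpleGraph V}
    (D : MateData G) {P : Set V} (hP : ∀ u ∈ P, D.mate u ∈ P) {u : V} (hu : u ∉ P)
    (h : Reaches A (stageGraph D P) (stageVerts D P)) :
    Reaches A (stageGraph D (insert u (insert (D.mate u) P)))
      (stageVerts D (insert u (insert (D.mate u) P))) := by
  obtain ⟨v, hv⟩ : ∃ v, v = D.mate u := ⟨_, rfl⟩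
  have hvu : D.mate v = u := by rw [hv, D.mate_mate]
  rw [← hv]
  have hvP : v ∉ P := fun h => hu (hvu ▸ hP v h)
  have huv : G.Adj u v := (D.adj_iff u true v).2 (Or.inl hv)
  have huv' := huv.ne
  have hvu' : G.Adj v u := huv.symm
  have asel : ∀ u c, G.Adj u (D.sel u c) := fun u c => (D.adj_iff u c _).2 (by simp)
  have aoth : ∀ u c, G.Adj u (D.oth u c) := fun u c => (D.adj_iff u c _).2 (by simp)
  have msel : ∀ u c, u ≠ D.mate (D.sel u c) := fun u c h =>
    D.sel_ne_mate u c (by conv_rhs => rw [h, D.mate_mate])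
  have nsel := D.sel_ne_mate
  have noth := D.oth_ne_mate
  have nso := D.sel_ne_oth
  have asel' : ∀ u c, G.Adj (D.sel u c) u := fun u c => (asel u c).symm
  have selne : ∀ u c, D.sel u c ≠ u := fun u c => (asel u c).ne.symm
  have memS : ∀ x, x ∈ stageVerts D P ↔ G.Adj x.1 x.2.1 ∧ (x.2.1 = D.mate x.1 → x.1 ∈ P) :=
    fun x => Iff.rfl
  refine h.splitPair (fun x => x.2.2) ?_ ?_
    (x₀ := (u, D.sel u false, false)) (x₁ := (u, D.sel u true, true))
    (y₀ := (u, D.oth u false, false)) (y₁ := (u, D.oth u true, true))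
    (z₀ := (v, D.sel v false, false)) (z₁ := (v, D.sel v true, true))
    (r₀ := (v, D.oth v false, false)) (r₁ := (v, D.oth v true, true))
    (o₀ := (D.sel u false, u, true)) (o₁ := (D.sel u true, u, false))
    (a₀ := (u, v, false)) (a₁ := (u, v, true)) (b₀ := (v, u, false)) (b₁ := (v, u, true))
    ?_ ?_ ?_ ?_ ?_ ?_ ?_ ?_ ?_ ?_ ?_ ?_ ?_ ?_ ?_ ?_ ?_ ?_ ?_ ?_ ?_ ?_ ?_ ?_ ?_ ?_ ?_ ?_
    rfl rfl rfl rfl rfl rfl rfl rfl ?_ ?_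
  · rintro ⟨p, q, c⟩ ⟨p', q', c'⟩ h
    rw [stageGraph_adj] at h
    exact h.1
  · rintro ⟨p, q, c⟩ ⟨p', q', c'⟩ h
    rw [stageGraph_adj] at h
    exact h.2.1
  · simp [stageGraph_adj, asel, nsel]
  · simp [stageGraph_adj, asel, aoth, nsel, noth]
  · simp [stageGraph_adj, asel, aoth, nsel, noth]
  · simp [stageGraph_adj, asel, nsel, hv, hu, hv ▸ hvP]
  · simp [stageGraph_adj, asel, nsel, hv, hu, hv ▸ hvP]
  · simp [stageGraph_adj, asel, asel', nsel, msel]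
  · simp [stageGraph_adj, asel, asel', nsel, msel]
  · simp [memS, aoth, noth]
  · simp [memS, aoth, noth]
  · simp [memS, aoth, noth]
  · simp [nso]
  · simp [nso]
  · simp [huv']
  · simp [huv']
  · simp [huv']
  · simp [huv']
  · simp [(selne _ _).symm]
  · simp [(selne _ _).symm]
  · simp [(selne _ _).symm]
  · simp [(selne _ _).symm]
  · simp [hv, (nsel _ _).symm]
  · simp [hv, (nsel _ _).symm]
  · simp [memS, hv, hu]
  · simp [memS, hv, hu]
  · simp [memS, hvu, hvP, hvu']
  · simp [memS, hvu, hvP, hvu']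
  · simp [huv']
  · simp [huv']
  · rintro ⟨p, q, c⟩ ⟨p', q', c'⟩
    simp only [stageGraph_adj, Prod.mk.injEq, Set.mem_insert_iff]
    have hm := D.mate_mate
    have e := D.adj_iff p c q
    have e' := D.adj_iff p' c' q'
    have q1 := D.adj_iff u c
    have q2 := D.adj_iff v c
    have q3 := D.adj_iff u c'
    have q4 := D.adj_iff v c'
    have k1 := hm p
    have k2 := hm p'
    have n1 := nsel p c
    have n2 := nsel p' c'
    have n3 := noth p c
    have n4 := noth p' c'
    clear msel memS h nsel noth hm nso selne asel asel' aoth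
    cases c <;> cases c' <;> simp only [reduceCtorEq, and_false, and_true, false_and, or_false,
      false_or, ne_eq, not_true_eq_false, not_false_eq_true, true_and]
    all_goals
      by_cases hp : p = u
      · by_cases hp' : p' = u
        · grind (splits := 30)
        · by_cases hp' : p' = v
          · grind (splits := 30)
          · grind (splits := 30)
      · by_cases hp : p = v
        · grind (splits := 30)
        · grind (splits := 30)
  · rintro ⟨p, q, c⟩
    simp only [stageVerts, Set.mem_ofPred_eq, Set.mem_insert_iff, Prod.mk.injEq]
    cases c <;> grind

lemma Reaches.stage_univ {V : Type} [Finite V] {A : BundledGraph} {G : SimpleGraph V}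
    (D : MateData G) {P : Set V} (hP : ∀ u ∈ P, D.mate u ∈ P)
    (h : Reaches A (stageGraph D P) (stageVerts D P)) :
    Reaches A (stageGraph D Set.univ) (stageVerts D Set.univ) := by
  induction hn : Pᶜ.ncard using Nat.strong_induction_on generalizing P with
  | _ n ih =>
    by_cases hPu : P = Set.univ
    · rwa [hPu] at h
    · obtain ⟨u, hu⟩ := (Set.ne_univ_iff_exists_notMem P).1 hPu
      refine ih _ ?_ ?_ (h.stage_insert D hP hu) rfl
      · rw [← hn]
        refine Set.ncard_lt_ncard ⟨Set.compl_subset_compl.2 fun a ha => by simp [ha], fun h => ?_⟩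
        exact h (Set.mem_compl hu) (Set.mem_insert u _)
      · have := D.mate_mate
        simp only [Set.mem_insert_iff]
        grind

lemma hexagonGraph_adj {G : SimpleGraph V} {idx : V → V → ZMod 6}
    (hpar : ∀ u v, G.Adj u v → (idx u v).val % 2 = (idx v u).val % 2) {u v : V} {i j : ZMod 6} :
    (hexagonGraph G idx).Adj (u, i) (v, j) ↔ (u = v ∧ i.val % 2 ≠ j.val % 2) ∨
      G.Adj u v ∧ (i = idx u v ∧ j = idx v u + 3 ∨ i = idx u v + 3 ∧ j = idx v u) := by
  have key : ∀ i j : ZMod 6, (i ≠ j ∧ ((j = i + 1 ∨ j = i + 3) ∨ (i = j + 1 ∨ i = j + 3))) ↔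
    i.val % 2 ≠ j.val % 2 := by decide
  have white : ∀ (u v : V) (i j : ZMod 6), IsWhite G idx s((u, i), (v, j)) ↔
      G.Adj u v ∧ (i = idx u v ∧ j = idx v u + 3 ∨ i = idx u v + 3 ∧ j = idx v u) := by
    intro u v i j
    constructor
    · rintro ⟨a, b, hab, h⟩
      have := hab.symm
      simp only [whitePairs, if_pos (hpar a b hab), Sym2.eq_iff, Prod.mk.injEq] at h
      grind
    · rintro ⟨hab, h⟩
      refine ⟨u, v, hab, ?_⟩
      simp only [whitePairs, if_pos (hpar u v hab), Sym2.eq_iff, Prod.mk.injEq]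
      grind
  have h := G.adj_comm u v
  have hne : G.Adj u v → u ≠ v := fun h => h.ne
  rw [← key]
  simp only [hexagonGraph, SimpleGraph.fromRel_adj, white, Prod.mk.injEq, ne_eq]
  grind

/-- The index of the neighbor `w` at `u`: the matching neighbor receives index `1`. -/
noncomputable def MateData.idx {G : SimpleGraph V} (D : MateData G) (u w : V) : ZMod 6 :=
  open Classical in if w = D.mate u then 1 else if w = D.sel u true then 0 else 2

lemma MateData.goodIdx {G : SimpleGraph V} (D : MateData G) : GoodIdx G D.idx := by
  constructor
  · intro v u _
    unfold MateData.idx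
    split_ifs <;> decide
  · intro v u w hu hw huw
    rw [D.adj_iff v true] at hu hw
    have := D.sel_ne_mate v true
    have := D.oth_ne_mate v true
    have := D.sel_ne_oth v true
    have : (1 : ZMod 6) ≠ 0 := by decide
    have : (1 : ZMod 6) ≠ 2 := by decide
    have : (0 : ZMod 6) ≠ 2 := by decide
    unfold MateData.idx
    grind

lemma exists_iso_hexagonGraph {G : SimpleGraph V} (D : MateData G) {α : Type}
    {H : SimpleGraph α} (f : H ↪g stageGraph D Set.univ)
    (hf : Set.range f = stageVerts D Set.univ) :
    Nonempty (H ≃g hexagonGraph G D.idx) := by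
  let par : ZMod 6 → Bool := fun i => i.val % 2 == 0
  let sh : ZMod 6 → Bool → ZMod 6 := fun i c => if par i = c then i else i + 3
  let g : V × V × Bool → V × ZMod 6 := fun x => (x.1, sh (D.idx x.1 x.2.1) x.2.2)
  have idxmem : ∀ u w, D.idx u w = 0 ∨ D.idx u w = 1 ∨ D.idx u w = 2 := by
    intro u w; unfold MateData.idx; split_ifs <;> simp
  have shpar : ∀ i c, par (sh i c) = c := by decide
  have shinj : ∀ i j c c', (i = 0 ∨ i = 1 ∨ i = 2) → (j = 0 ∨ j = 1 ∨ j = 2) →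
    sh i c = sh j c' → i = j ∧ c = c' := by decide
  have idxinj : ∀ u w w', G.Adj u w → G.Adj u w' → D.idx u w = D.idx u w' → w = w' := by
    intro u w w' h h' he
    by_contra hne
    exact D.goodIdx.2 u w w' h h' hne he
  have mem : ∀ a, G.Adj (f a).1 (f a).2.1 := fun a =>
    (show f a ∈ stageVerts D Set.univ from hf ▸ ⟨a, rfl⟩).1
  have inj : Function.Injective fun a => g (f a) := by
    intro a a' h
    replace h : g (f a) = g (f a') := h
    apply f.injective
    have m := mem a
    have m' := mem a'
    revert h m m'
    rcases f a with ⟨u, w, c⟩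
    rcases f a' with ⟨u', w', c'⟩
    simp only [g, Prod.mk.injEq]
    rintro ⟨rfl, h⟩ m m'
    obtain ⟨h1, rfl⟩ := shinj _ _ _ _ (idxmem _ _) (idxmem _ _) h
    exact ⟨rfl, idxinj _ _ _ m m' h1, rfl⟩
  have surj : Function.Surjective fun a => g (f a) := by
    rintro ⟨u, i⟩
    have hi : ∃ j : ZMod 6, (j = 0 ∨ j = 1 ∨ j = 2) ∧ ∃ c, sh j c = i := by
      revert i; decide
    obtain ⟨j, hj, c, rfl⟩ := hi
    have : ∃ w, G.Adj u w ∧ D.idx u w = j := by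
      have := D.adj_iff u true
      have := D.sel_ne_mate u true
      have := D.oth_ne_mate u true
      have := D.sel_ne_oth u true
      unfold MateData.idx
      rcases hj with rfl | rfl | rfl
      · exact ⟨D.sel u true, by grind⟩
      · exact ⟨D.mate u, by grind⟩
      · exact ⟨D.oth u true, by grind⟩
    obtain ⟨w, hw, rfl⟩ := this
    obtain ⟨a, ha⟩ : (u, w, c) ∈ Set.range f := by
      rw [hf]; exact ⟨hw, fun _ => trivial⟩
    exact ⟨a, by simp [ha, g]⟩
  have hpar : ∀ u w, G.Adj u w → par (D.idx u w) = par (D.idx w u) := by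
    intro u w h
    have hm : w = D.mate u ↔ u = D.mate w := by
      constructor <;> rintro rfl <;> simp [D.mate_mate]
    have p0 : par 0 = true := by decide
    have p2 : par 2 = true := by decide
    unfold MateData.idx
    split_ifs <;> grind
  have hpar' : ∀ u w, G.Adj u w → (D.idx u w).val % 2 = (D.idx w u).val % 2 := by
    have : ∀ i j : ZMod 6, par i = par j → i.val % 2 = j.val % 2 := by decide
    exact fun u w h => this _ _ (hpar u w h)
  refine ⟨⟨Equiv.ofBijective _ ⟨inj, surj⟩, ?_⟩⟩
  intro a a'
  change (hexagonGraph G D.idx).Adj (g (f a)) (g (f a')) ↔ H.Adj a a'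
  rw [← f.map_adj_iff]
  have m := mem a
  have m' := mem a'
  revert m m'
  rcases f a with ⟨u, w, c⟩
  rcases f a' with ⟨u', w', c'⟩
  intro m m'
  simp only [stageGraph_adj, g, hexagonGraph_adj hpar'] at m m' ⊢
  rcases eq_or_ne u u' with rfl | hne
  · have : ∀ i j : ZMod 6, i.val % 2 ≠ j.val % 2 ↔ par i ≠ par j := by decide
    rw [this, shpar, shpar]
    simp [m, m']
  · have sh1 : ∀ i c, sh i c = i ↔ c = par i := by decide
    have sh2 : ∀ i c, sh i c = i + 3 ↔ c ≠ par i := by decide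
    have shinj' : ∀ i j c, (i = 0 ∨ i = 1 ∨ i = 2) → (j = 0 ∨ j = 1 ∨ j = 2) →
      (sh i c = j ∨ sh i c = j + 3) → i = j := by decide
    constructor
    · rintro (⟨h, -⟩ | ⟨h, h'⟩)
      · exact absurd h hne
      have e1 := idxinj _ _ _ m h (shinj' _ _ c (idxmem _ _) (idxmem _ _) (by tauto))
      have e2 := idxinj _ _ _ m' h.symm (shinj' _ _ c' (idxmem _ _) (idxmem _ _) (by tauto))
      have := hpar _ _ h
      subst e1 e2
      rw [sh1, sh2, sh1, sh2] at h'
      refine ⟨by grind, by simp [m], by simp [m'], by simp⟩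
    · rintro ⟨hc, -, -, h⟩
      obtain ⟨rfl, rfl⟩ : u' = w ∧ u = w' := by simpa [hne] using h
      have := hpar _ _ m
      refine Or.inr ⟨m, ?_⟩
      rw [sh1, sh2, sh1, sh2]
      grind

section SquareGraph

variable {G : SimpleGraph V} {M : Set (Sym2 V)} (S : SquareGraph G M)

lemma mem_sqSupp {v : V} {T : Set (Sym2 (V × ZMod 4))} {i : ZMod 4} :
    (v, i) ∈ sqSupp v T ↔ ∃ e ∈ T, (v, i) ∈ e := by
  simp [sqSupp]

lemma SquareGraph.exists_mem_sqSupp_iff {u v : V} (h : G.Adj u v) :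
    ∃ j, ∀ i, (u, i) ∈ sqSupp u (S.pr u v) ↔ i = j ∨ i = j + 1 := by
  have := h.ne
  obtain ⟨j, k, h | h⟩ := S.pr_shape u v h <;>
  exact ⟨j, fun i => by simp [mem_sqSupp, h, this]⟩

lemma SquareGraph.color_succ (C : S.Q.Coloring Bool) (v : V) (i : ZMod 4) :
    C (v, i + 1) = !C (v, i) := by
  have := C.valid ((S.intra v i (i + 1)).2 (Or.inl rfl))
  grind

lemma SquareGraph.adj_iff_of_adj (C : S.Q.Coloring Bool) {u v : V} (h : G.Adj u v)
    (i l : ZMod 4) :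
    S.Q.Adj (u, i) (v, l) ↔ (u, i) ∈ sqSupp u (S.pr u v) ∧ (v, l) ∈ sqSupp v (S.pr u v) ∧
      C (u, i) ≠ C (v, l) := by
  have hne := h.ne
  have inter := fun i l => (S.inter u v i l hne)
  obtain ⟨j, k, hp⟩ := S.pr_shape u v h
  have valid : S.Q.Adj (u, j) (v, k) := by
    rw [inter]; exact ⟨h, by rcases hp with hp | hp <;> simp [hp]⟩
  replace valid := C.valid valid
  have c1 := S.color_succ C u j
  have c2 := S.color_succ C v k
  have c3 := S.color_succ C v (k + 3)
  have k4 : k + 3 + 1 = k := by clear * -; decide +revert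
  rw [k4] at c3
  have hj : j ≠ j + 1 := by clear * -; decide +revert
  have hk : k ≠ k + 1 := by clear * -; decide +revert
  have hk' : k ≠ k + 3 := by clear * -; decide +revert
  rw [inter]
  rcases hp with hp | hp
  · simp [mem_sqSupp, hp, hne, hne.symm, h]
    grind
  · simp [mem_sqSupp, hp, hne, hne.symm, h]
    grind

lemma SquareGraph.eq_of_mem_sqSupp (C : S.Q.Coloring Bool) {u v : V} (h : G.Adj u v)
    {i i' : ZMod 4} (hi : (u, i) ∈ sqSupp u (S.pr u v)) (hi' : (u, i') ∈ sqSupp u (S.pr u v))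
    (hc : C (u, i) = C (u, i')) : i = i' := by
  obtain ⟨j, hj⟩ := S.exists_mem_sqSupp_iff h
  rw [hj] at hi hi'
  have := S.color_succ C u j
  grind

lemma SquareGraph.exists_mem_sqSupp_color (C : S.Q.Coloring Bool) {u v : V} (h : G.Adj u v)
    (c : Bool) : ∃ i, (u, i) ∈ sqSupp u (S.pr u v) ∧ C (u, i) = c := by
  obtain ⟨j, hj⟩ := S.exists_mem_sqSupp_iff h
  have := S.color_succ C u j
  by_cases hc : C (u, j) = c
  · exact ⟨j, by simp [hj], hc⟩
  · exact ⟨j + 1, by simp [hj], by grind⟩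

lemma SquareGraph.adj_same_iff (C : S.Q.Coloring Bool) (u : V) (i i' : ZMod 4) :
    S.Q.Adj (u, i) (u, i') ↔ C (u, i) ≠ C (u, i') := by
  refine ⟨fun h => C.valid h, fun h => ?_⟩
  have c1 := S.color_succ C u i
  have c2 := S.color_succ C u (i + 1)
  have h4 : i' = i ∨ i' = i + 1 ∨ i' = i + 1 + 1 ∨ i = i' + 1 := by
    clear * -; decide +revert
  rw [S.intra]
  rcases h4 with rfl | rfl | rfl | rfl <;> simp_all

end SquareGraph

/-- Every vertex of a square lies in the support of exactly one non-matching edge, whose other end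
is `next u i`. The label `D.sel u c` is the non-matching neighbor of `u` whose support meets
the support of the matching edge in the vertex of color `c`. -/
lemma SquareGraph.exists_mateData {G : SimpleGraph V} (hG : IsCubic G)
    {M : G.Subgraph} (hM : M.IsPerfectMatching) (S : SquareGraph G M.edgeSet)
    (C : S.Q.Coloring Bool) :
    ∃ (D : MateData G) (next : V → ZMod 4 → V),
      (∀ u i, G.Adj u (next u i)) ∧ (∀ u i, next u i ≠ D.mate u) ∧
      (∀ u i w, G.Adj u w → w ≠ D.mate u →
        ((u, i) ∈ sqSupp u (S.pr u w) ↔ next u i = w)) ∧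
      ∀ u i, (u, i) ∈ sqSupp u (S.pr u (D.mate u)) ↔ next u i = D.sel u (C (u, i)) := by
  rw [Subgraph.isPerfectMatching_iff] at hM
  choose mate hmate mate_unique using hM
  simp only at mate_unique
  have gmate : ∀ u, G.Adj u (mate u) := fun u => (hmate u).adj_sub
  have mate_mate : ∀ u, mate (mate u) = u := fun u => (mate_unique _ _ (hmate u).symm).symm
  let sup : V → V → ZMod 4 → Prop := fun u v i => (u, i) ∈ sqSupp u (S.pr u v)
  have hsup : ∀ u v, G.Adj u v → ∃ j, ∀ i, sup u v i ↔ i = j ∨ i = j + 1 := fun u v h =>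
    S.exists_mem_sqSupp_iff h
  have nbrs : ∀ u, ∃ a b, a ≠ mate u ∧ b ≠ mate u ∧ a ≠ b ∧
      (∀ w, G.Adj u w ↔ w = mate u ∨ w = a ∨ w = b) ∧ ∀ j, sup u a j ↔ ¬ sup u b j := by
    intro u
    obtain ⟨x, y, z, hxy, hxz, hyz, hset⟩ := Set.ncard_eq_three.1 (hG u)
    have hw : ∀ w, G.Adj u w ↔ w = x ∨ w = y ∨ w = z := fun w => by
      simpa using Set.ext_iff.1 hset w
    have hm := (hw _).1 (gmate u)
    obtain ⟨a, b, ha, hb, hab, hw⟩ : ∃ a b, a ≠ mate u ∧ b ≠ mate u ∧ a ≠ b ∧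
        ∀ w, G.Adj u w ↔ w = mate u ∨ w = a ∨ w = b := by
      rcases hm with rfl | rfl | rfl
      · exact ⟨y, z, by grind⟩
      · exact ⟨x, z, by grind⟩
      · exact ⟨x, y, by grind⟩
    refine ⟨a, b, ha, hb, hab, hw, ?_⟩
    have ga : G.Adj u a := (hw a).2 (by simp)
    have gb : G.Adj u b := (hw b).2 (by simp)
    have dis := S.matched u (mate u) a b (gmate u) ga gb ha.symm hb.symm hab (hmate u).symm
    rw [S.pr_symm a, S.pr_symm b, Set.disjoint_left] at dis
    have dis : ∀ j, sup u a j → ¬ sup u b j := fun j h => dis h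
    obtain ⟨p, hp⟩ := hsup u a ga
    obtain ⟨q, hq⟩ := hsup u b gb
    simp only [hp, hq] at dis ⊢
    clear * - dis
    decide +revert
  choose a b ha hb hab hw hsab using nbrs
  have sel : ∀ u c, ∃ s o, s ≠ mate u ∧ o ≠ mate u ∧ s ≠ o ∧
      (∀ w, G.Adj u w ↔ w = mate u ∨ w = s ∨ w = o) ∧
      ∀ j, C (u, j) = c → (sup u s j ↔ sup u (mate u) j) := by
    intro u c
    have ga : G.Adj u (a u) := (hw u _).2 (by simp)
    have gb : G.Adj u (b u) := (hw u _).2 (by simp)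
    obtain ⟨j, hj, hjc⟩ :=
      S.exists_mem_sqSupp_color C (gmate u) c
    have key : ∀ s, G.Adj u s → sup u s j →
        ∀ j', C (u, j') = c → (sup u s j' ↔ sup u (mate u) j') := by
      intro s hs hsj j' hj'
      have e1 := S.eq_of_mem_sqSupp C hs (i := j) (i' := j')
      have e2 := S.eq_of_mem_sqSupp C (gmate u) (i := j) (i' := j')
      grind
    have hab' := hsab u
    by_cases h : sup u (a u) j
    · exact ⟨a u, b u, ha u, hb u, hab u, hw u, key _ ga h⟩
    · exact ⟨b u, a u, hb u, ha u, (hab u).symm, by grind, key _ gb (by grind)⟩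
  choose sel oth h1 h2 h3 h4 h5 using sel
  let D : MateData G := ⟨mate, sel, oth, mate_mate, fun u c w => h4 u c w, h1, h2, h3⟩
  have hnext : ∀ u j, ∃ w, G.Adj u w ∧ w ≠ mate u ∧
      ∀ w', G.Adj u w' → w' ≠ mate u → (sup u w' j ↔ w' = w) := by
    intro u j
    by_cases h : sup u (a u) j
    · exact ⟨a u, by grind⟩
    · exact ⟨b u, by grind⟩
  choose next n1 n2 n3 using hnext
  refine ⟨D, next, n1, n2, fun u i w h h' => (n3 u i w h h').trans eq_comm, fun u i => ?_⟩
  change sup u (mate u) i ↔ next u i = sel u (C (u, i))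
  rw [← h5 u _ i rfl, n3 u i _ ((h4 u (C (u, i)) _).2 (by simp)) (h1 _ _), eq_comm]

lemma SquareGraph.exists_reaches {G : SimpleGraph V} (hG : IsCubic G)
    {M : G.Subgraph} (hM : M.IsPerfectMatching) (S : SquareGraph G M.edgeSet) :
    ∃ D : MateData G, Reaches ⟨V × ZMod 4, S.Q⟩ (stageGraph D ∅) (stageVerts D ∅) := by
  obtain ⟨C₀⟩ := S.bip
  let C : S.Q.Coloring Bool := Coloring.mk (fun x => C₀ x = 0) (by
    intro x y h
    have := C₀.valid h
    generalize C₀ x = a at *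
    generalize C₀ y = b at *
    revert a b; decide)
  obtain ⟨D, next, adj_next, next_ne, next_iff, mate_iff⟩ := S.exists_mateData hG hM C
  refine ⟨D, _, .refl, ⟨⟨fun x : V × ZMod 4 => (x.1, next x.1 x.2, C x), ?_⟩, ?_⟩, ?_⟩
  · rintro ⟨u, i⟩ ⟨u', i'⟩ h
    simp only [Prod.mk.injEq] at h
    obtain ⟨rfl, hn, hc⟩ := h
    have h := fun j => next_iff u j _ (adj_next u i) (next_ne u i)
    rw [S.eq_of_mem_sqSupp C (adj_next u i) ((h i).2 rfl) ((h i').2 hn.symm) hc]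
  · rintro ⟨u, i⟩ ⟨u', i'⟩
    change (stageGraph D ∅).Adj (u, next u i, C (u, i)) (u', next u' i', C (u', i')) ↔
      S.Q.Adj (u, i) (u', i')
    simp only [stageGraph_adj, adj_next, next_ne, Set.mem_empty_iff_false, not_false_eq_true,
      false_imp_iff, and_true, true_and]
    by_cases hu : u = u'
    · subst hu
      simp [S.adj_same_iff C]
    by_cases hg : G.Adj u u'
    · rw [S.adj_iff_of_adj C hg]
      by_cases hm : u' = D.mate u
      · have hm' : u = D.mate u' := by rw [hm, D.mate_mate]
        have e1 : (u, i) ∈ sqSupp u (S.pr u u') ↔ _ := hm ▸ mate_iff u i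
        have e2 : (u', i') ∈ sqSupp u' (S.pr u' u) ↔ _ := hm' ▸ mate_iff u' i'
        have e3 : u' ≠ next u i := hm ▸ (next_ne u i).symm
        rw [e1, S.pr_symm u, e2]
        simp only [hu, e3, false_and, false_or, ← hm, true_and]
        tauto
      · have hm' : u ≠ D.mate u' := fun h => hm (by rw [h, D.mate_mate])
        rw [next_iff u i u' hg hm, S.pr_symm u, next_iff u' i' u hg.symm hm']
        simp only [hu, hm, false_and, false_or, or_false]
        tauto
    · have e1 : u' ≠ next u i := fun h => hg (h ▸ adj_next u i)
      have e2 : u' ≠ D.mate u := fun h => hg ((D.adj_iff u true u').2 (Or.inl h))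
      simp [S.inter _ _ _ _ hu, hu, hg, e1, e2]
  · ext ⟨u, w, c⟩
    constructor
    · rintro ⟨⟨u, i⟩, h⟩
      cases h
      exact ⟨adj_next u i, fun h => absurd h (next_ne u i)⟩
    · rintro ⟨hw : G.Adj u w, hm : w = D.mate u → u ∈ ∅⟩
      obtain ⟨i, hi, rfl⟩ := S.exists_mem_sqSupp_color C hw c
      have : next u i = w := (next_iff u i w hw hm).1 hi
      exact ⟨(u, i), by rw [← this]; rfl⟩

/-- from any `M`-square graph of a cubic bridgeless graph `G` one can
generate a hexagon graph of `G` by a sequence of simple augmentations. -/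
theorem stmt13 {V : Type} [Fintype V] [DecidableEq V] (G : SimpleGraph V)
    (hG : IsCubic G) (hB : Bridgeless G)
    (M : G.Subgraph) (hM : M.IsPerfectMatching) (S : SquareGraph G M.edgeSet) :
    ∃ (k : ℕ) (Hs : Fin (k + 1) → BundledGraph),
      Hs 0 = ⟨V × ZMod 4, S.Q⟩ ∧
      (∀ i : Fin (k + 1), (Hs i).graph.Colorable 2) ∧
      (∀ i : Fin k, IsSimpleAug (Hs i.castSucc) (Hs i.succ)) ∧
      ∃ idx : V → V → ZMod 6, GoodIdx G idx ∧
        Nonempty ((Hs (Fin.last k)).graph ≃g hexagonGraph G idx) := by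
  obtain ⟨D, hD⟩ := S.exists_reaches hG hM
  obtain ⟨B, hB', f, hf⟩ := hD.stage_univ D (by simp)
  obtain ⟨k, Hs, h0, hk, hs⟩ := exists_sequence hB'
  refine ⟨k, fun i => Hs i, h0, ?_, fun i => (hs i i.2).1, D.idx, D.goodIdx, ?_⟩
  · rintro ⟨i, hi⟩
    cases i with
    | zero =>
      change (Hs 0).graph.Colorable 2
      rw [h0]
      exact S.bip
    | succ i => exact (hs i (by omega)).2
  · change Nonempty ((Hs k).graph ≃g _)
    rw [hk]
    exact exists_iso_hexagonGraph D f hf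

end Hex
end

section
/- Let G be a finite simple cubic bridgeless graph, M a perfect matching of G, and Q an M-square graph of G. For every connected component C of G − M (each such component is a cycle, since G is cubic), the graph obtained from Q by deleting all edges in ⋃_{e ∈ M} ⟦e⟧ has a connected component that is a ladder on 4·|V(C)| vertices whose squares are exactly the squares s_v for v ∈ V(C). -/
open SimpleGraph

namespace Hex

variable {V : Type}

/-- The double cover of `ZMod n` by `ZMod (2 * n)`: the class of `2 i + b`. -/
def doubleIndex (n : ℕ) (i : ZMod n) (b : Bool) : ZMod (2 * n) :=
  ((2 * i.val + b.toNat : ℕ) : ZMod (2 * n))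

lemma doubleIndex_true (n : ℕ) (i : ZMod n) :
    doubleIndex n i true = doubleIndex n i false + 1 := by
  simp [doubleIndex]

lemma doubleIndex_add_one_false (n : ℕ) [NeZero n] (i : ZMod n) :
    doubleIndex n (i + 1) false = doubleIndex n i true + 1 := by
  have h : (i + 1).val ≡ i.val + 1 [MOD n] := by
    rw [← ZMod.natCast_eq_natCast_iff]
    simp
  have h2 := (ZMod.natCast_eq_natCast_iff _ _ _).2 (h.mul_left' 2)
  simp only [doubleIndex, Bool.toNat_false, Bool.toNat_true, add_zero]
  rw [h2]
  push_cast
  ring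

lemma doubleIndex_inj (n : ℕ) [NeZero n] {i i' : ZMod n} {b b' : Bool} :
    doubleIndex n i b = doubleIndex n i' b' ↔ i = i' ∧ b = b' := by
  refine ⟨fun h => ?_, by rintro ⟨rfl, rfl⟩; rfl⟩
  have hi := i.val_lt
  have hi' := i'.val_lt
  have hb := b.toNat_lt
  have hb' := b'.toNat_lt
  rw [doubleIndex, doubleIndex, ZMod.natCast_eq_natCast_iff', Nat.mod_eq_of_lt (by lia),
    Nat.mod_eq_of_lt (by lia)] at h
  refine ⟨ZMod.val_injective n (by lia), ?_⟩
  cases b <;> cases b' <;> simp at h ⊢ <;> lia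

lemma exists_doubleIndex_eq (n : ℕ) [NeZero n] (t : ZMod (2 * n)) :
    ∃ i b, doubleIndex n i b = t := by
  have ht := t.val_lt
  refine ⟨((t.val / 2 : ℕ) : ZMod n), decide (t.val % 2 = 1), ?_⟩
  rw [doubleIndex, ZMod.val_natCast, Nat.mod_eq_of_lt (by lia)]
  conv_rhs => rw [← ZMod.natCast_zmod_val t]
  congr 1
  rcases Nat.mod_two_eq_zero_or_one t.val with h | h <;> simp [h] <;> lia

lemma doubleIndex_eq_add_one (n : ℕ) [NeZero n] {i i' : ZMod n} {b b' : Bool} :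
    doubleIndex n i' b' = doubleIndex n i b + 1 ↔
      (i' = i ∧ b = false ∧ b' = true) ∨ (i' = i + 1 ∧ b = true ∧ b' = false) := by
  cases b
  · rw [← doubleIndex_true, doubleIndex_inj]
    simp
  · rw [← doubleIndex_add_one_false, doubleIndex_inj]
    simp

lemma zmod_two_eq_of_ne {a b c : ZMod 2} (h : a ≠ b) (h' : c ≠ b) : a = c := by
  revert a b c
  decide

/-- In the 2-colouring of the ladder given by `s + t`, two vertices are adjacent iff they have
distinct colours and their second coordinates differ by at most one. -/
lemma ladder_adj_iff (n : ℕ) [NeZero n] (s s' : ZMod 2) (t t' : ZMod (2 * n)) :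
    (ladder (2 * n)).Adj (s, t) (s', t') ↔
      s + ZMod.castHom (dvd_mul_right 2 n) (ZMod 2) t ≠
        s' + ZMod.castHom (dvd_mul_right 2 n) (ZMod 2) t' ∧
      (t' = t ∨ t' = t + 1 ∨ t = t' + 1) := by
  set p := ZMod.castHom (dvd_mul_right 2 n) (ZMod 2)
  have hne : ∀ u : ZMod (2 * n), u + 1 ≠ u := fun u h => by
    have := congrArg p h
    rw [map_add, map_one] at this
    revert this
    generalize p u = a
    revert a
    decide
  have h01 : ∀ a b u : ZMod 2, (a + u ≠ b + (u + 1) ↔ a = b) := by decide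
  have h10 : ∀ a b u : ZMod 2, (a + (u + 1) ≠ b + u ↔ a = b) := by decide
  have key : (ladder (2 * n)).Adj (s, t) (s', t') ↔
      (s, t) ≠ (s', t') ∧ (((s = s' ∧ t' = t + 1) ∨ (s ≠ s' ∧ t = t')) ∨
        ((s' = s ∧ t = t' + 1) ∨ (s' ≠ s ∧ t' = t))) := Iff.rfl
  rw [key]
  by_cases h0 : t' = t
  · subst h0
    have := hne t'
    simp only [ne_eq, Prod.mk.injEq, add_left_inj]
    grind
  by_cases h1 : t' = t + 1
  · subst h1
    rw [map_add, map_one, h01]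
    grind
  by_cases h2 : t = t' + 1
  · subst h2
    rw [map_add, map_one, h10]
    grind
  · grind

lemma nonempty_iso_ladder {W : Type} (H : SimpleGraph W) (n : ℕ) [NeZero n]
    (c : W → ZMod 2) (t : W → ZMod (2 * n))
    (hinj : ∀ x y, c x = c y → t x = t y → x = y) (hsurj : ∀ a b, ∃ x, c x = a ∧ t x = b)
    (hadj : ∀ x y, H.Adj x y ↔
      c x ≠ c y ∧ (t y = t x ∨ t y = t x + 1 ∨ t x = t y + 1)) :
    Nonempty (H ≃g ladder (2 * n)) := by
  let p := ZMod.castHom (dvd_mul_right 2 n) (ZMod 2)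
  let f : W → ZMod 2 × ZMod (2 * n) := fun x => (c x - p (t x), t x)
  have hf : Function.Bijective f := by
    constructor
    · intro x y h
      have h2 : t x = t y := congrArg Prod.snd h
      have h1 : c x - p (t x) = c y - p (t y) := congrArg Prod.fst h
      rw [h2] at h1
      exact hinj x y (sub_left_injective h1) h2
    · rintro ⟨a, b⟩
      obtain ⟨x, hx, hx'⟩ := hsurj (a + p b) b
      exact ⟨x, by simp [f, hx, hx']⟩
  refine ⟨⟨Equiv.ofBijective f hf, fun {x y} => ?_⟩⟩
  refine (ladder_adj_iff n (c x - p (t x)) (c y - p (t y)) (t x) (t y)).trans ?_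
  rw [hadj]
  simp [p]

/-- A component of a finite 2-regular graph is a cycle, parametrized by `ZMod n`. -/
lemma exists_cyclic_parametrization [Finite V] (H : SimpleGraph V)
    (hH : ∀ v, (H.neighborSet v).ncard = 2) (C : H.ConnectedComponent) :
    ∃ f : ZMod C.supp.ncard → V, NeZero C.supp.ncard ∧ Function.Injective f ∧
      Set.range f = C.supp ∧ (∀ i, f (i - 1) ≠ f (i + 1)) ∧
      ∀ i w, H.Adj (f i) w ↔ w = f (i - 1) ∨ w = f (i + 1) := by
  obtain ⟨v, hv⟩ := C.nonempty_supp
  have hc : H.IsCycles := fun w _ => hH w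
  obtain ⟨p, hp, hps⟩ := hc.exists_cycle_toSubgraph_verts_eq_connectedComponentSupp hv
    (Set.nonempty_of_ncard_ne_zero (by rw [hH]; decide))
  have hlen := hp.three_le_length
  have hz : NeZero p.length := ⟨by lia⟩
  let g : ZMod p.length → V := fun i => p.getVert i.val
  have hginj : Function.Injective g := fun i j h => by
    have hi := i.val_lt
    have hj := j.val_lt
    exact ZMod.val_injective _ (hp.getVert_injOn' (by simp; lia) (by simp; lia) h)
  have hgn : ∀ k ≤ p.length, p.getVert k = g (k : ZMod p.length) := fun k hk => by
    rcases hk.lt_or_eq with h | h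
    · simp [g, ZMod.val_natCast, Nat.mod_eq_of_lt h]
    · subst h
      simp [g]
  have hgrange : Set.range g = C.supp := by
    rw [← hps]
    ext w
    rw [Walk.mem_verts_toSubgraph, Walk.mem_support_iff_exists_getVert]
    constructor
    · rintro ⟨i, rfl⟩
      exact ⟨i.val, rfl, i.val_lt.le⟩
    · rintro ⟨k, rfl, hk⟩
      exact ⟨k, (hgn k hk).symm⟩
  have hcard : C.supp.ncard = p.length := by
    rw [← hgrange, ← Set.image_univ, Set.ncard_image_of_injective _ hginj, Set.ncard_univ,
      Nat.card_zmod]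
  have hsucc : ∀ i, H.Adj (g i) (g (i + 1)) := fun i => by
    have h := p.adj_getVert_succ i.val_lt
    rw [hgn _ (Nat.succ_le_of_lt i.val_lt)] at h
    simpa [g] using h
  have hne : ∀ i, g (i - 1) ≠ g (i + 1) := fun i h => by
    have h2 : ((2 : ℕ) : ZMod p.length) = 0 := by
      have := hginj h
      push_cast
      linear_combination -this
    have := Nat.le_of_dvd (by decide) ((ZMod.natCast_eq_zero_iff _ _).1 h2)
    lia
  rw [hcard]
  refine ⟨g, hz, hginj, hgrange, hne, fun i w => ?_⟩
  have hset : {g (i - 1), g (i + 1)} = H.neighborSet (g i) := by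
    refine Set.eq_of_subset_of_ncard_le ?_ ?_ (Set.toFinite _)
    · rintro w (rfl | rfl)
      · have := (hsucc (i - 1)).symm
        rwa [sub_add_cancel] at this
      · exact hsucc i
    · rw [hH, Set.ncard_pair (hne i)]
  rw [← mem_neighborSet, ← hset]
  rfl

lemma ncard_neighborSet_deleteEdges_matching [Finite V] {G : SimpleGraph V} (hG : IsCubic G)
    {M : G.Subgraph} (hM : M.IsPerfectMatching) (v : V) :
    ((G.deleteEdges M.edgeSet).neighborSet v).ncard = 2 := by
  obtain ⟨w, hw, huniq⟩ := Subgraph.isPerfectMatching_iff.1 hM v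
  have h : (G.deleteEdges M.edgeSet).neighborSet v = G.neighborSet v \ {w} := by
    ext z
    simp only [mem_neighborSet, deleteEdges_adj, Subgraph.mem_edgeSet, Set.mem_sdiff,
      Set.mem_singleton_iff]
    exact and_congr_right fun _ => not_congr ⟨fun h => huniq z h, fun h => h ▸ hw⟩
  rw [h, Set.ncard_sdiff_singleton_of_mem ((mem_neighborSet _ _ _).2 hw.adj_sub), hG]

namespace SquareGraph

variable {G : SimpleGraph V} {M : Set (Sym2 V)} (S : SquareGraph G M)

/-- The square graph with the projections of the edges of `M` deleted. -/
abbrev unmatched : SimpleGraph (V × ZMod 4) :=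
  S.Q.deleteEdges {e | ∃ u v : V, s(u, v) ∈ M ∧ e ∈ S.pr u v}

lemma exists_sqSupp_eq {u v : V} (h : G.Adj u v) :
    ∃ j : ZMod 4, sqSupp v (S.pr u v) = {(v, j), (v, j + 1)} := by
  have huv := h.ne
  obtain ⟨j, k, h | h⟩ := S.pr_shape u v h
  · refine ⟨k, ?_⟩
    ext ⟨x, a⟩
    simp [sqSupp, h]
    grind
  · have h4 : k + 3 + 1 = k := by
      clear h
      decide +revert
    refine ⟨k + 3, ?_⟩
    rw [h4]
    ext ⟨x, a⟩
    simp [sqSupp, h]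
    grind

lemma mem_pr_endpoints {u v x y : V} {j k : ZMod 4} (h : G.Adj u v)
    (hm : s((x, j), (y, k)) ∈ S.pr u v) : s(x, y) = s(u, v) := by
  obtain ⟨a, b, h | h⟩ := S.pr_shape u v h <;>
  · simp only [h, Set.mem_insert_iff, Set.mem_singleton_iff, Sym2.eq_iff, Prod.mk.injEq] at hm ⊢
    tauto

lemma adj_square_iff (c : S.Q.Coloring (ZMod 2)) (v : V) (j k : ZMod 4) :
    S.Q.Adj (v, j) (v, k) ↔ c (v, j) ≠ c (v, k) := by
  refine ⟨fun h => c.valid h, fun h => ?_⟩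
  rw [S.intra]
  have h1 : ∀ i : ZMod 4, c (v, i) ≠ c (v, i + 1) := fun i =>
    c.valid ((S.intra v i (i + 1)).2 (Or.inl rfl))
  by_contra hn
  have hjk : k = j ∨ k = j + 1 + 1 := by
    clear h h1
    decide +revert
  rcases hjk with rfl | rfl
  · exact h rfl
  · exact h (zmod_two_eq_of_ne (h1 j) (h1 (j + 1)).symm)

lemma mem_pr_iff (c : S.Q.Coloring (ZMod 2)) {u v : V} (h : G.Adj u v) (a b : ZMod 4) :
    s((u, a), (v, b)) ∈ S.pr u v ↔ c (u, a) ≠ c (v, b) ∧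
      (u, a) ∈ sqSupp u (S.pr u v) ∧ (v, b) ∈ sqSupp v (S.pr u v) := by
  have huv := h.ne
  refine ⟨fun hm => ⟨c.valid ((S.inter u v a b huv).2 ⟨h, hm⟩), ⟨rfl, _, hm, by simp⟩,
    ⟨rfl, _, hm, by simp⟩⟩, ?_⟩
  rintro ⟨hc, ⟨-, e, he, hae⟩, ⟨-, e', he', hbe⟩⟩
  have key : ∀ (j k l : ZMod 4), S.pr u v = {s((u, j), (v, k)), s((u, j + 1), (v, l))} →
      s((u, a), (v, b)) ∈ S.pr u v := by
    intro j k l hpr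
    have h1 : c (u, j) ≠ c (v, k) := c.valid ((S.inter u v _ _ huv).2 ⟨h, by simp [hpr]⟩)
    have h2 : c (u, j + 1) ≠ c (v, l) := c.valid ((S.inter u v _ _ huv).2 ⟨h, by simp [hpr]⟩)
    have h3 : c (u, j) ≠ c (u, j + 1) := c.valid ((S.intra u j (j + 1)).2 (Or.inl rfl))
    rw [hpr] at he he' ⊢
    have ha : a = j ∨ a = j + 1 := by
      rcases he with rfl | rfl <;> simp [huv] at hae <;> simp [hae]
    have hb : b = k ∨ b = l := by
      rcases he' with rfl | rfl <;> simp [huv.symm] at hbe <;> simp [hbe]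
    rcases ha with rfl | rfl <;> rcases hb with rfl | rfl
    · simp
    · exact absurd (zmod_two_eq_of_ne h3 h2.symm) hc
    · exact absurd (zmod_two_eq_of_ne h3.symm h1.symm) hc
    · simp
  obtain ⟨j, k, h | h⟩ := S.pr_shape u v h
  · exact key _ _ _ h
  · exact key _ _ _ h

lemma unmatched_adj_square_iff (hM : M ⊆ G.edgeSet) (v : V) (j k : ZMod 4) :
    S.unmatched.Adj (v, j) (v, k) ↔ S.Q.Adj (v, j) (v, k) := by
  rw [deleteEdges_adj]
  refine and_iff_left ?_
  rintro ⟨x, y, hxy, hm⟩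
  have hG : G.Adj x y := hM hxy
  have h := S.mem_pr_endpoints hG hm
  rw [Sym2.eq_iff] at h
  exact hG.ne (by grind)

lemma unmatched_adj_iff_of_ne (hM : M ⊆ G.edgeSet) {u v : V} (huv : u ≠ v) (j k : ZMod 4) :
    S.unmatched.Adj (u, j) (v, k) ↔
      (G.deleteEdges M).Adj u v ∧ s((u, j), (v, k)) ∈ S.pr u v := by
  rw [deleteEdges_adj, deleteEdges_adj, S.inter u v j k huv]
  constructor
  · rintro ⟨⟨h, hm⟩, hn⟩
    exact ⟨⟨h, fun h' => hn ⟨u, v, h', hm⟩⟩, hm⟩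
  · rintro ⟨⟨h, hn⟩, hm⟩
    refine ⟨⟨h, hm⟩, ?_⟩
    rintro ⟨x, y, hxy, hm'⟩
    exact hn (S.mem_pr_endpoints (hM hxy) hm' ▸ hxy)

lemma unmatched_adj_iff (hM : M ⊆ G.edgeSet) (c : S.Q.Coloring (ZMod 2)) (x y : V × ZMod 4) :
    S.unmatched.Adj x y ↔ c x ≠ c y ∧ (x.1 = y.1 ∨ (G.deleteEdges M).Adj x.1 y.1 ∧
      x ∈ sqSupp x.1 (S.pr x.1 y.1) ∧ y ∈ sqSupp y.1 (S.pr x.1 y.1)) := by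
  obtain ⟨u, j⟩ := x
  obtain ⟨v, k⟩ := y
  by_cases huv : u = v
  · subst huv
    rw [S.unmatched_adj_square_iff hM, S.adj_square_iff c]
    simp
  · rw [S.unmatched_adj_iff_of_ne hM huv]
    simp only [huv, false_or]
    rw [and_left_comm]
    exact and_congr_right fun h => S.mem_pr_iff c (deleteEdges_adj.1 h).1 j k

lemma unmatched_reachable_square (hM : M ⊆ G.edgeSet) (v : V) (j k : ZMod 4) :
    S.unmatched.Reachable (v, j) (v, k) := by
  have h : ∀ i : ℕ, S.unmatched.Reachable (v, 0) (v, (i : ZMod 4)) := by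
    intro i
    induction i with
    | zero => simp
    | succ i ih =>
      refine ih.trans (Adj.reachable ?_)
      rw [S.unmatched_adj_square_iff hM, S.intra]
      simp
  have hall : ∀ i : ZMod 4, S.unmatched.Reachable (v, 0) (v, i) := fun i => by
    simpa using h i.val
  exact (hall j).symm.trans (hall k)

lemma unmatched_reachable_iff (hM : M ⊆ G.edgeSet) (x y : V × ZMod 4) :
    S.unmatched.Reachable x y ↔ (G.deleteEdges M).Reachable x.1 y.1 := by
  constructor
  · rintro ⟨w⟩
    induction w with
    | nil => exact Reachable.refl _
    | @cons x y z h w ih =>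
      refine Reachable.trans ?_ ih
      obtain ⟨u, j⟩ := x
      obtain ⟨v, k⟩ := y
      by_cases huv : u = v
      · subst huv
        exact Reachable.refl _
      · exact ((S.unmatched_adj_iff_of_ne hM huv j k).1 h).1.reachable
  · obtain ⟨u, j⟩ := x
    obtain ⟨v, k⟩ := y
    rintro ⟨w⟩
    change (G.deleteEdges M).Walk u v at w
    induction w generalizing j with
    | nil => exact S.unmatched_reachable_square hM _ _ _
    | @cons u v z h w ih =>
      obtain ⟨a, b, h'⟩ := S.pr_shape u v (deleteEdges_adj.1 h).1
      have hab : S.unmatched.Adj (u, a) (v, b) :=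
        (S.unmatched_adj_iff_of_ne hM h.ne a b).2 ⟨h, by rcases h' with h' | h' <;> simp [h']⟩
      exact ((S.unmatched_reachable_square hM u j a).trans hab.reachable).trans (ih b)

/-- If the supporting edges of two projections at `v` are disjoint, they partition the square
of `v`. -/
lemma mem_sqSupp_iff_not_mem {u v w : V} (hu : G.Adj u v) (hw : G.Adj v w)
    (hd : Disjoint (sqSupp v (S.pr u v)) (sqSupp v (S.pr v w))) (a : ZMod 4) :
    (v, a) ∈ sqSupp v (S.pr u v) ↔ (v, a) ∉ sqSupp v (S.pr v w) := by
  obtain ⟨j, hj⟩ := S.exists_sqSupp_eq hu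
  obtain ⟨k, hk⟩ := S.exists_sqSupp_eq hw.symm
  rw [S.pr_symm w v] at hk
  rw [hj, hk] at hd ⊢
  simp only [Set.disjoint_insert_left, Set.disjoint_singleton_left, Set.mem_insert_iff,
    Set.mem_singleton_iff, Prod.mk.injEq, true_and] at hd ⊢
  clear hj hk
  decide +revert

/-- The supporting edge in the square of `f i` of the projection of the edge of the cycle `f`
that enters (`false`) or leaves (`true`) the vertex `f i`. -/
def cycleSupp {n : ℕ} (f : ZMod n → V) (i : ZMod n) (b : Bool) : Set (V × ZMod 4) :=
  bif b then sqSupp (f i) (S.pr (f i) (f (i + 1))) else sqSupp (f i) (S.pr (f (i - 1)) (f i))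

lemma fst_of_mem_cycleSupp {n : ℕ} {f : ZMod n → V} {i : ZMod n} {b : Bool} {x : V × ZMod 4}
    (h : x ∈ S.cycleSupp f i b) : x.1 = f i := by
  cases b <;> exact h.1

lemma exists_cycleSupp_eq {n : ℕ} {f : ZMod n → V} (hf : ∀ i, G.Adj (f i) (f (i + 1)))
    (i : ZMod n) (b : Bool) : ∃ j : ZMod 4, S.cycleSupp f i b = {(f i, j), (f i, j + 1)} := by
  cases b
  · exact S.exists_sqSupp_eq (by simpa using hf (i - 1))
  · obtain ⟨j, hj⟩ := S.exists_sqSupp_eq (hf i).symm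
    rw [S.pr_symm] at hj
    exact ⟨j, hj⟩

lemma eq_of_mem_cycleSupp (c : S.Q.Coloring (ZMod 2)) {n : ℕ} {f : ZMod n → V}
    (hf : ∀ i, G.Adj (f i) (f (i + 1))) {i : ZMod n} {b : Bool} {x y : V × ZMod 4}
    (hx : x ∈ S.cycleSupp f i b) (hy : y ∈ S.cycleSupp f i b) (hc : c x = c y) : x = y := by
  obtain ⟨j, hj⟩ := S.exists_cycleSupp_eq hf i b
  have h : c (f i, j) ≠ c (f i, j + 1) := c.valid ((S.intra _ j (j + 1)).2 (Or.inl rfl))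
  rw [hj] at hx hy
  rcases hx with rfl | rfl <;> rcases hy with rfl | rfl <;> simp_all

lemma exists_mem_cycleSupp_color (c : S.Q.Coloring (ZMod 2)) {n : ℕ} {f : ZMod n → V}
    (hf : ∀ i, G.Adj (f i) (f (i + 1))) (i : ZMod n) (b : Bool) (a : ZMod 2) :
    ∃ x ∈ S.cycleSupp f i b, c x = a := by
  obtain ⟨j, hj⟩ := S.exists_cycleSupp_eq hf i b
  have h : c (f i, j) ≠ c (f i, j + 1) := c.valid ((S.intra _ j (j + 1)).2 (Or.inl rfl))
  by_cases ha : c (f i, j) = a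
  · exact ⟨_, by simp [hj], ha⟩
  · exact ⟨(f i, j + 1), by simp [hj], zmod_two_eq_of_ne h.symm (Ne.symm ha)⟩

/-- Adjacency between the squares along a cycle of `G - M`, in terms of the positions of the
supporting edges containing the two vertices. -/
lemma unmatched_adj_iff_doubleIndex (hM : M ⊆ G.edgeSet) (c : S.Q.Coloring (ZMod 2))
    {n : ℕ} [NeZero n] {f : ZMod n → V} (hinj : Function.Injective f)
    (hnb : ∀ i w, (G.deleteEdges M).Adj (f i) w ↔ w = f (i - 1) ∨ w = f (i + 1))
    (hpart : ∀ i a, (f i, a) ∈ S.cycleSupp f i false ↔ (f i, a) ∉ S.cycleSupp f i true)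
    {i i' : ZMod n} {b b' : Bool} {x y : V × ZMod 4}
    (hx : x ∈ S.cycleSupp f i b) (hy : y ∈ S.cycleSupp f i' b') :
    S.unmatched.Adj x y ↔ c x ≠ c y ∧
      (doubleIndex n i' b' = doubleIndex n i b ∨ doubleIndex n i' b' = doubleIndex n i b + 1 ∨
        doubleIndex n i b = doubleIndex n i' b' + 1) := by
  rw [S.unmatched_adj_iff hM c]
  refine and_congr_right fun _ => ?_
  simp only [doubleIndex_inj, doubleIndex_eq_add_one]
  obtain ⟨u, k⟩ := x
  obtain ⟨v, l⟩ := y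
  obtain rfl : u = f i := S.fst_of_mem_cycleSupp hx
  obtain rfl : v = f i' := S.fst_of_mem_cycleSupp hy
  have htrue : ∀ {i b k}, (f i, k) ∈ S.cycleSupp f i b →
      (f i, k) ∈ sqSupp (f i) (S.pr (f i) (f (i + 1))) → b = true := by
    intro i b k h h'
    cases b
    · exact absurd h' ((hpart i k).1 h)
    · rfl
  have hfalse : ∀ {i b k}, (f (i + 1), k) ∈ S.cycleSupp f (i + 1) b →
      (f (i + 1), k) ∈ sqSupp (f (i + 1)) (S.pr (f i) (f (i + 1))) → b = false := by
    intro i b k h h'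
    cases b
    · rfl
    · refine absurd h ((hpart (i + 1) k).1 ?_)
      simpa [cycleSupp] using h'
  constructor
  · rintro (h | ⟨h, hx', hy'⟩)
    · obtain rfl := hinj h
      cases b <;> cases b' <;> simp
    · rcases (hnb i _).1 h with h | h
      · obtain rfl := hinj h
        obtain ⟨i', rfl⟩ : ∃ i', i = i' + 1 := ⟨i - 1, by ring⟩
        simp only [add_sub_cancel_right] at *
        rw [S.pr_symm] at hx' hy'
        exact Or.inr (Or.inr (Or.inr ⟨by simp, htrue hy hy', hfalse hx hx'⟩))
      · obtain rfl := hinj h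
        exact Or.inr (Or.inl (Or.inr ⟨rfl, htrue hx hx', hfalse hy hy'⟩))
  · rintro (⟨rfl, -⟩ | (⟨rfl, -⟩ | ⟨rfl, rfl, rfl⟩) | (⟨rfl, -⟩ | ⟨rfl, rfl, rfl⟩))
    · exact Or.inl rfl
    · exact Or.inl rfl
    · refine Or.inr ⟨(hnb _ _).2 (Or.inr rfl), hx, ?_⟩
      simpa [cycleSupp] using hy
    · exact Or.inl rfl
    · refine Or.inr ⟨((hnb _ _).2 (Or.inr rfl)).symm, ?_, ?_⟩
      · rw [S.pr_symm]
        simpa [cycleSupp] using hx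
      · rw [S.pr_symm]
        exact hy

end SquareGraph

/-- for every connected component `C` of `G − M` (a cycle), deleting all
projection edges of the edges of `M` from an `M`-square graph leaves a connected component
that is a ladder on `4·|V(C)|` vertices whose squares are exactly the `s_v`, `v ∈ C`. -/
theorem stmt14 {V : Type} [Fintype V] [DecidableEq V] (G : SimpleGraph V)
    (hG : IsCubic G) (hB : Bridgeless G)
    (M : G.Subgraph) (hM : M.IsPerfectMatching) (S : SquareGraph G M.edgeSet) :
    ∀ C : (G.deleteEdges M.edgeSet).ConnectedComponent,
      ∃ c : (S.Q.deleteEdges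
          {e | ∃ u v : V, s(u, v) ∈ M.edgeSet ∧ e ∈ S.pr u v}).ConnectedComponent,
        c.supp = {p : V × ZMod 4 | p.1 ∈ C.supp} ∧
        Nonempty (((S.Q.deleteEdges
            {e | ∃ u v : V, s(u, v) ∈ M.edgeSet ∧ e ∈ S.pr u v}).induce c.supp) ≃g
          ladder (2 * C.supp.ncard)) := by
  intro C
  have hME : M.edgeSet ⊆ G.edgeSet := M.edgeSet_subset
  obtain ⟨f, hz, hinj, hrange, hne, hnb⟩ := exists_cyclic_parametrization
    (G.deleteEdges M.edgeSet) (ncard_neighborSet_deleteEdges_matching hG hM) C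
  obtain ⟨c⟩ : Nonempty (S.Q.Coloring (ZMod 2)) := S.bip
  have hf : ∀ i, G.Adj (f i) (f (i + 1)) := fun i =>
    (deleteEdges_adj.1 ((hnb i _).2 (Or.inr rfl))).1
  have hpart : ∀ i a, (f i, a) ∈ S.cycleSupp f i false ↔
      (f i, a) ∉ S.cycleSupp f i true := by
    intro i a
    have hprev := deleteEdges_adj.1 ((hnb i _).2 (Or.inl rfl))
    have hnext := deleteEdges_adj.1 ((hnb i _).2 (Or.inr rfl))
    obtain ⟨u, hu, -⟩ := Subgraph.isPerfectMatching_iff.1 hM (f i)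
    have hd := S.matched (f i) u (f (i - 1)) (f (i + 1)) hu.adj_sub hprev.1 hnext.1
      (by rintro rfl; exact hprev.2 hu) (by rintro rfl; exact hnext.2 hu) (hne i) hu.symm
    rw [S.pr_symm (f (i + 1))] at hd
    exact S.mem_sqSupp_iff_not_mem hprev.1.symm hnext.1 hd a
  have hsupp : (S.unmatched.connectedComponentMk (f 0, 0)).supp =
      {p : V × ZMod 4 | p.1 ∈ C.supp} := by
    ext x
    have h0 : f 0 ∈ C.supp := hrange.subset (Set.mem_range_self 0)
    rw [ConnectedComponent.mem_supp_iff, ConnectedComponent.eq, S.unmatched_reachable_iff hME,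
      ← ConnectedComponent.eq, (ConnectedComponent.mem_supp_iff _ _).1 h0]
    rfl
  refine ⟨_, hsupp, ?_⟩
  change Nonempty (S.unmatched.induce (S.unmatched.connectedComponentMk (f 0, 0)).supp ≃g _)
  rw [hsupp]
  have hpos : ∀ x : {p : V × ZMod 4 | p.1 ∈ C.supp}, ∃ i b, x.1 ∈ S.cycleSupp f i b := by
    rintro ⟨⟨v, a⟩, hv⟩
    obtain ⟨i, rfl⟩ : v ∈ Set.range f := hrange.superset hv
    by_cases h : (f i, a) ∈ S.cycleSupp f i true
    · exact ⟨i, true, h⟩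
    · exact ⟨i, false, (hpart i a).2 h⟩
  choose I B hIB using hpos
  refine nonempty_iso_ladder _ _ (fun x => c x.1) (fun x => doubleIndex _ (I x) (B x))
    (fun x y hc ht => ?_) (fun a t => ?_) (fun x y => ?_)
  · obtain ⟨hI, hB'⟩ := (doubleIndex_inj _).1 ht
    have hx := hIB x
    rw [hI, hB'] at hx
    exact Subtype.ext (S.eq_of_mem_cycleSupp c hf hx (hIB y) hc)
  · obtain ⟨i, b, rfl⟩ := exists_doubleIndex_eq _ t
    obtain ⟨x, hx, hcx⟩ := S.exists_mem_cycleSupp_color c hf i b a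
    have hx1 := S.fst_of_mem_cycleSupp hx
    let x' : {p : V × ZMod 4 | p.1 ∈ C.supp} := ⟨x, by
      rw [Set.mem_ofPred_eq, hx1, ← hrange]
      exact Set.mem_range_self i⟩
    refine ⟨x', hcx, (doubleIndex_inj _).2 ?_⟩
    have hx' : x ∈ S.cycleSupp f (I x') (B x') := hIB x'
    have hI : I x' = i := hinj ((S.fst_of_mem_cycleSupp hx').symm.trans hx1)
    refine ⟨hI, ?_⟩
    rw [hI] at hx'
    have hp := hpart i x.2
    rw [← hx1, Prod.mk.eta] at hp
    cases hb : B x' <;> cases b <;> simp_all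
  · exact S.unmatched_adj_iff_doubleIndex hME c hinj hnb hpart (hIB x) (hIB y)

end Hex
end

section
/- For every odd ear decomposition (G_0, G_i, P_i)^l of a finite simple cubic bridgeless graph G, there exists a perfect matching M of G that is absolute in (G_0, G_i, P_i)^l. -/
open SimpleGraph

namespace Hex

variable {V : Type}

/-- The relation pairing `f (2 * k)` with `f (2 * k + 1)` for every `k < n`. -/
def PairRel (f : ℕ → V) (n : ℕ) (x y : V) : Prop :=
  ∃ k < n, (x = f (2 * k) ∧ y = f (2 * k + 1)) ∨ (y = f (2 * k) ∧ x = f (2 * k + 1))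

theorem PairRel.symm {f : ℕ → V} {n : ℕ} {x y : V} (h : PairRel f n x y) :
    PairRel f n y x := by
  obtain ⟨k, hk, h⟩ := h
  exact ⟨k, hk, h.symm⟩

theorem PairRel.exists_left {f : ℕ → V} {n : ℕ} {x y : V} (h : PairRel f n x y) :
    ∃ m < 2 * n, x = f m := by
  obtain ⟨k, hk, h | h⟩ := h
  · exact ⟨2 * k, by omega, h.1⟩
  · exact ⟨2 * k + 1, by omega, h.2⟩

theorem PairRel.of_consecutive {f : ℕ → V} {n : ℕ} {K : V → V → Prop}
    (hK : ∀ x y, K x y → K y x) (hf : ∀ m, m + 1 < 2 * n → K (f m) (f (m + 1)))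
    {x y : V} (h : PairRel f n x y) : K x y := by
  obtain ⟨k, hk, ⟨rfl, rfl⟩ | ⟨rfl, rfl⟩⟩ := h
  · exact hf _ (by omega)
  · exact hK _ _ (hf _ (by omega))

theorem existsUnique_pairRel {f : ℕ → V} {n : ℕ} (hf : Set.InjOn f {m | m < 2 * n})
    {m : ℕ} (hm : m < 2 * n) : ∃! w, PairRel f n (f m) w := by
  obtain ⟨k, rfl | rfl⟩ := Nat.even_or_odd' m
  · refine ⟨f (2 * k + 1), ⟨k, by omega, Or.inl ⟨rfl, rfl⟩⟩, ?_⟩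
    rintro w ⟨j, hj, ⟨h, rfl⟩ | ⟨rfl, h⟩⟩
    · have := hf hm (show 2 * j < 2 * n by omega) h
      rw [this]
    · have := hf hm (show 2 * j + 1 < 2 * n by omega) h
      omega
  · refine ⟨f (2 * k), ⟨k, by omega, Or.inr ⟨rfl, rfl⟩⟩, ?_⟩
    rintro w ⟨j, hj, ⟨h, rfl⟩ | ⟨rfl, h⟩⟩
    · have := hf hm (show 2 * j < 2 * n by omega) h
      omega
    · have := hf hm (show 2 * j + 1 < 2 * n by omega) h
      congr 1
      omega

/-- `R` is the adjacency relation of a perfect matching of the subgraph `K`. -/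
structure IsMatchingRel {G : SimpleGraph V} (K : G.Subgraph) (R : V → V → Prop) : Prop where
  symm : ∀ x y, R x y → R y x
  adj : ∀ x y, R x y → K.Adj x y
  existsUnique : ∀ v ∈ K.verts, ∃! w, R v w

theorem exists_isMatchingRel_of_isCycle {G : SimpleGraph V} {v : V} {c : G.Walk v v}
    (hc : c.IsCycle) (he : Even c.length) : ∃ R, IsMatchingRel c.toSubgraph R := by
  obtain ⟨n, hn⟩ := he
  have h3 := hc.three_le_length
  refine ⟨PairRel c.getVert n, fun _ _ h => h.symm, fun _ _ h =>
    PairRel.of_consecutive (f := c.getVert) (n := n) (K := c.toSubgraph.Adj) (fun _ _ h => h.symm)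
      (fun m hm => c.toSubgraph_adj_getVert (by omega)) h, ?_⟩
  intro w hw
  rw [Walk.mem_verts_toSubgraph, Walk.mem_support_iff_exists_getVert] at hw
  have hinj : Set.InjOn c.getVert {m | m < 2 * n} :=
    hc.getVert_injOn'.mono fun m (hm : m < 2 * n) => show m ≤ c.length - 1 by omega
  obtain ⟨m, rfl, hm⟩ := hw
  rcases hm.lt_or_eq with hm | rfl
  · exact existsUnique_pairRel hinj (by omega)
  · have h := existsUnique_pairRel hinj (m := 0) (by omega)
    rw [c.getVert_zero] at h
    rwa [c.getVert_length]

/-- A perfect matching of a subgraph extends over an odd ear; the new edges avoid the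
old vertices. -/
theorem IsMatchingRel.exists_extend {G : SimpleGraph V} {K : G.Subgraph} {R : V → V → Prop}
    (hR : IsMatchingRel K R) {a b : V} {p : G.Walk a b} (hp : p.IsPath) (ho : Odd p.length)
    (ha : a ∈ K.verts) (hb : b ∈ K.verts)
    (hdisj : ∀ w ∈ p.support, w ≠ a → w ≠ b → w ∉ K.verts) :
    ∃ R', IsMatchingRel (K ⊔ p.toSubgraph) R' ∧ ∀ x ∈ K.verts, ∀ y, R' x y → R x y := by
  obtain ⟨n, hn⟩ := ho
  set f : ℕ → V := fun m => p.getVert (m + 1) with hf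
  have hfK : ∀ m < 2 * n, f m ∉ K.verts := by
    intro m hm
    refine hdisj _ (p.getVert_mem_support _) (fun h => ?_) (fun h => ?_)
    · rw [hp.getVert_eq_start_iff (by omega)] at h
      omega
    · rw [hp.getVert_eq_end_iff (by omega)] at h
      omega
  have hinj : Set.InjOn f {m | m < 2 * n} := by
    intro i (hi : i < 2 * n) j (hj : j < 2 * n) h
    have := hp.getVert_injOn (show i + 1 ≤ p.length by omega)
      (show j + 1 ≤ p.length by omega) h
    omega
  have hold : ∀ x ∈ K.verts, ∀ y, ¬ PairRel f n x y := by
    intro x hx y h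
    obtain ⟨m, hm, rfl⟩ := h.exists_left
    exact hfK m hm hx
  refine ⟨fun x y => R x y ∨ PairRel f n x y, ⟨?_, ?_, ?_⟩, ?_⟩
  · rintro x y (h | h)
    · exact Or.inl (hR.symm _ _ h)
    · exact Or.inr h.symm
  · rintro x y (h | h)
    · exact Subgraph.sup_adj.2 (Or.inl (hR.adj _ _ h))
    · exact Subgraph.sup_adj.2 (Or.inr (h.of_consecutive (K := p.toSubgraph.Adj)
        (fun _ _ h => h.symm) (fun m hm => p.toSubgraph_adj_getVert (by omega))))
  · intro v hv
    by_cases hvK : v ∈ K.verts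
    · simpa [hold v hvK] using hR.existsUnique v hvK
    · have hvp : v ∈ p.support := by
        simpa [hvK] using hv
      obtain ⟨m, rfl, hm⟩ := Walk.mem_support_iff_exists_getVert.1 hvp
      have h0 : m ≠ 0 := by
        rintro rfl
        exact hvK (by simpa using ha)
      have h1 : m ≠ p.length := by
        rintro rfl
        exact hvK (by simpa using hb)
      have hnR : ∀ y, ¬ R (p.getVert m) y := fun y h => hvK (hR.adj _ _ h).fst_mem
      have key := existsUnique_pairRel hinj (m := m - 1) (by omega)
      have hfm : f (m - 1) = p.getVert m := by
        simp only [hf]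
        congr 1
        omega
      rw [hfm] at key
      simpa [hnR] using key
  · rintro x hx y (h | h)
    · exact h
    · exact absurd h (hold x hx y)

theorem OddEarDecomp.exists_isMatchingRel {G : SimpleGraph V} (D : OddEarDecomp G)
    (i : Fin (D.l + 1)) : ∃ R, IsMatchingRel (D.Gs i) R ∧
      ∀ j ≤ i, ∀ x ∈ (D.Gs j).verts, x ∈ (D.Gs i).verts ∧
        ∀ y, R x y → (D.Gs j).Adj x y := by
  induction i using Fin.induction with
  | zero =>
    obtain ⟨v, c, hc, he, h0⟩ := D.base
    obtain ⟨R, hR⟩ := exists_isMatchingRel_of_isCycle hc he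
    rw [← h0] at hR
    refine ⟨R, hR, fun j hj x hx => ?_⟩
    obtain rfl : j = 0 := Fin.le_zero_iff.1 hj
    exact ⟨hx, hR.adj x⟩
  | succ i ih =>
    obtain ⟨R, hR, hRj⟩ := ih
    obtain ⟨a, b, p, hp, ho, ha, hb, hdisj, -, hG⟩ := D.ear i
    obtain ⟨R', hR', hext⟩ := hR.exists_extend hp ho ha hb hdisj
    rw [← hG] at hR'
    refine ⟨R', hR', fun j hj x hx => ?_⟩
    rcases hj.lt_or_eq with hj | rfl
    · obtain ⟨hxi, hadj⟩ := hRj j (Fin.le_castSucc_iff.2 hj) x hx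
      refine ⟨?_, fun y h => hadj y (hext x hxi y h)⟩
      rw [hG]
      exact Or.inl hxi
    · exact ⟨hx, hR'.adj x⟩

/-- for every odd ear decomposition of a cubic bridgeless graph there is a
perfect matching that is absolute in it. -/
theorem stmt15 {V : Type} [Fintype V] [DecidableEq V] (G : SimpleGraph V)
    (hG : IsCubic G) (hB : Bridgeless G) (D : OddEarDecomp G) :
    ∃ M : G.Subgraph, M.IsPerfectMatching ∧ AbsoluteIn M D := by
  obtain ⟨R, hR, hRj⟩ := D.exists_isMatchingRel (Fin.last D.l)
  have hex : ∀ v, ∃! w, R v w := fun v => hR.existsUnique v (by simp [D.top])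
  refine ⟨⟨Set.univ, R, fun h => (hR.adj _ _ h).adj_sub, fun _ => trivial,
    ⟨fun _ _ => hR.symm _ _⟩⟩, ⟨fun v _ => hex v, fun _ => trivial⟩, fun j v hv => ?_⟩
  obtain ⟨w, hw, huniq⟩ := hex v
  exact ⟨w, ⟨hw, (hRj j (Fin.le_last j) v hv).2 w hw⟩, fun y hy => huniq y hy.1⟩

end Hex
end
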